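/- arXiv:2509.20038 — 2 statements merged into one kernel-verified Lean document; each statement's English description precedes it below -/
import Mathlib

section
/- Every 2-connected [4,2]-graph of order at least 7 is pancyclic. -/
def edgesWithin {V : Type*} [DecidableEq V] (G : SimpleGraph V) [DecidableRel G.Adj]
    (A : Finset V) : ℕ := (A.sym2.filter (· ∈ G.edgeSet)).card

/-- `G` is an `[s,t]`-graph: every induced subgraph on `s` vertices has at least `t` edges. -/
def IsSTGraph {V : Type*} [DecidableEq V] (G : SimpleGraph V) [DecidableRel G.Adj]
    (s t : ℕ) : Prop := ∀ A : Finset V, A.card = s → t ≤ edgesWithin G A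
/-- `G` is 2-connected: at least 3 vertices and deleting any single vertex leaves it connected. -/
def TwoConnected {V : Type*} [Fintype V] (G : SimpleGraph V) : Prop :=
  3 ≤ Fintype.card V ∧ ∀ v : V, (G.induce {u : V | u ≠ v}).Connected
/-- `G` is pancyclic: it has cycles of every length from 3 to its order. -/
def Pancyclic {V : Type*} [Fintype V] (G : SimpleGraph V) : Prop :=
  ∀ k : ℕ, 3 ≤ k → k ≤ Fintype.card V →
    ∃ (v : V) (c : G.Walk v v), c.IsCycle ∧ c.length = k

set_option linter.unusedSimpArgs false
section Helpers

variable {V : Type*} {G : SimpleGraph V}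

/-- `L` is a walk (as a list of vertices) from `a` to `b`. -/
def Seg (G : SimpleGraph V) (L : List V) (a b : V) : Prop :=
  L.IsChain G.Adj ∧ L.head? = some a ∧ L.getLast? = some b

/-- there is a cycle with `k` vertices, in list form. -/
def HasCyc (G : SimpleGraph V) (k : ℕ) : Prop :=
  ∃ L a b, Seg G L a b ∧ L.Nodup ∧ G.Adj b a ∧ L.length = k

theorem Seg.single (a : V) : Seg G [a] a a := by simp [Seg]

theorem Seg.append {L M : List V} {a b c d : V} (h1 : Seg G L a b) (h2 : Seg G M c d)
    (h : G.Adj b c) : Seg G (L ++ M) a d := by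
  obtain ⟨x1, x2, x3⟩ := h1
  obtain ⟨y1, y2, y3⟩ := h2
  refine ⟨?_, ?_, ?_⟩
  · rw [List.isChain_append]
    refine ⟨x1, y1, ?_⟩
    intro x hx y hy
    simp_all
  · simp [List.head?_append, x2]
  · simp [List.getLast?_append, y3]

theorem Seg.cons {M : List V} {b c d : V} (h : G.Adj b c) (h2 : Seg G M c d) :
    Seg G (b :: M) b d := by
  simpa using (Seg.single b).append h2 h

theorem Seg.rev {L : List V} {a b : V} (h1 : Seg G L a b) : Seg G L.reverse b a := by
  obtain ⟨x1, x2, x3⟩ := h1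
  refine ⟨?_, by simpa using x3, by simpa using x2⟩
  rw [List.isChain_reverse]
  exact x1.imp fun _ _ h => h.symm

theorem Seg.mem_left {L : List V} {a b : V} (h1 : Seg G L a b) : a ∈ L :=
  List.mem_of_mem_head? h1.2.1

theorem Seg.mem_right {L : List V} {a b : V} (h1 : Seg G L a b) : b ∈ L :=
  List.mem_of_mem_getLast? h1.2.2

theorem Seg.split {L : List V} {a b : V} (h1 : Seg G L a b) (hn : L.Nodup) :
    (a = b ∧ L = [a]) ∨ (a ≠ b ∧ ∃ c L', L = a :: L' ∧ Seg G L' c b ∧ G.Adj a c) := by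
  obtain ⟨x1, x2, x3⟩ := h1
  match L, x1, x2, x3, hn with
  | [u], x1, x2, x3, hn => simp_all
  | u :: v :: T, x1, x2, x3, hn =>
    right
    simp only [List.head?_cons, Option.some.injEq] at x2
    subst x2
    have hb : b ∈ v :: T := by
      apply List.mem_of_mem_getLast?
      simpa using x3
    refine ⟨?_, v, v :: T, rfl, ⟨?_, rfl, by simpa using x3⟩, ?_⟩
    · rintro rfl
      simp [List.nodup_cons] at hn hb
      grind
    · exact (List.isChain_cons_cons.1 x1).2
    · exact (List.isChain_cons_cons.1 x1).1

theorem HasCyc.mk {L M : List V} {a b : V} (h : Seg G L a b) (hab : G.Adj b a)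
    (hp : L.Perm M) (hM : M.Nodup) {k : ℕ} (hk : M.length = k) : HasCyc G k :=
  ⟨L, a, b, h, hp.nodup_iff.2 hM, hab, by rw [hp.length_eq, hk]⟩

theorem Seg.of_cut {S T : List V} {a b u t : V} (h : Seg G (S ++ u :: T) a b)
    (hS : S.getLast? = some t) : Seg G S a t ∧ G.Adj t u := by
  obtain ⟨x1, x2, x3⟩ := h
  rw [List.isChain_append] at x1
  refine ⟨⟨x1.1, ?_, hS⟩, ?_⟩
  · cases S
    · simp at hS
    · simpa using x2
  · apply x1.2.2 t (by simp [hS]) u (by simp)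

theorem Seg.of_cut' {S T : List V} {a b u : V} (h : Seg G (S ++ u :: T) a b) :
    Seg G (u :: T) u b := by
  obtain ⟨x1, x2, x3⟩ := h
  rw [List.isChain_append] at x1
  exact ⟨x1.2.1, by simp, by simpa using x3⟩

/-- rotate a cycle so that it starts at `u`. -/
theorem rotate_cyc {L : List V} {a b u : V} (h : Seg G L a b) (hab : G.Adj b a) (hu : u ∈ L) :
    ∃ T b', Seg G (u :: T) u b' ∧ G.Adj b' u ∧ (u :: T).Perm L := by
  obtain ⟨S, T, rfl⟩ := List.append_of_mem hu
  rcases hS : S.getLast? with _ | t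
  · rw [List.getLast?_eq_none_iff] at hS
    subst hS
    have : a = u := by have := h.2.1; simpa using this.symm
    subst this
    exact ⟨T, b, h, hab, by simp⟩
  · obtain ⟨h1, h2⟩ := h.of_cut hS
    have h3 := h.of_cut'
    exact ⟨T ++ S, t, h3.append h1 hab, h2, by
      rw [← List.cons_append]; exact List.perm_append_comm⟩

/-- a segment (possibly empty) strictly between `p` and `q` -/
def Betw (G : SimpleGraph V) (A : List V) (p q : V) : Prop :=
  (A = [] ∧ G.Adj p q) ∨ ∃ a a', Seg G A a a' ∧ G.Adj p a ∧ G.Adj a' q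

theorem cyc_decomp {L : List V} {a b p q : V} (h : Seg G L a b) (hab : G.Adj b a)
    (hp : p ∈ L) (hq : q ∈ L) (hpq : p ≠ q) :
    ∃ A B, Betw G A p q ∧ Betw G B q p ∧ (p :: q :: (A ++ B)).Perm L := by
  obtain ⟨T, b', h1, h2, h3⟩ := rotate_cyc h hab hp
  have hqT : q ∈ T := by
    have := h3.mem_iff.2 hq
    simp only [List.mem_cons] at this
    tauto
  obtain ⟨A, B, rfl⟩ := List.append_of_mem hqT
  refine ⟨A, B, ?_, ?_, ?_⟩
  · rcases A with _ | ⟨a1, A'⟩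
    · left; exact ⟨rfl, (List.isChain_cons_cons.1 h1.1).1⟩
    · right
      rcases hS : (a1 :: A').getLast? with _ | t
      · simp at hS
      · have hh : Seg G ((a1 :: A') ++ q :: B) a1 b' := by
          refine ⟨(List.isChain_cons_cons.1 h1.1).2, by simp, by simpa using h1.2.2⟩
        obtain ⟨h4, h5⟩ := hh.of_cut hS
        exact ⟨a1, t, h4, (List.isChain_cons_cons.1 h1.1).1, h5⟩
  · have h4 : Seg G (q :: B) q b' := Seg.of_cut' (S := p :: A) (by simpa using h1)
    rcases B with _ | ⟨b1, B'⟩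
    · left
      refine ⟨rfl, ?_⟩
      have : q = b' := by simpa using h4.2.2
      rwa [this]
    · right
      exact ⟨b1, b', ⟨(List.isChain_cons_cons.1 h4.1).2, by simp, by simpa using h4.2.2⟩,
        (List.isChain_cons_cons.1 h4.1).1, h2⟩
  · refine List.Perm.trans ?_ h3
    refine List.Perm.cons _ ?_
    exact List.perm_middle.symm

theorem HasCyc.walk {k : ℕ} (hk : 3 ≤ k) (h : HasCyc G k) :
    ∃ (v : V) (c : G.Walk v v), c.IsCycle ∧ c.length = k := by
  obtain ⟨L, a, b, ⟨h1, h2, h3⟩, hn, hab, hl⟩ := h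
  have hne : L ≠ [] := by rintro rfl; simp at h2
  have ea : L.head hne = a := by
    have := List.head?_eq_some_head hne
    rw [h2] at this; simpa using this.symm
  have eb : L.getLast hne = b := by
    have := List.getLast?_eq_some_getLast hne
    rw [h3] at this; simpa using this.symm
  subst ea eb
  let p := SimpleGraph.Walk.ofSupport (G := G) L hne h1
  have hpp : p.IsPath := by
    rw [SimpleGraph.Walk.isPath_def, SimpleGraph.Walk.support_ofSupport]; exact hn
  have hpl : p.length + 1 = k := by
    rw [← hl]
    have := SimpleGraph.Walk.length_support p
    rw [SimpleGraph.Walk.support_ofSupport] at this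
    exact this.symm
  refine ⟨_, SimpleGraph.Walk.cons hab p, ?_, by simpa using hpl⟩
  rw [SimpleGraph.Walk.cons_isCycle_iff]
  refine ⟨hpp, fun hm => ?_⟩
  rw [Sym2.eq_swap] at hm
  have := hpp.length_eq_one_of_mem_edges hm
  omega

/-- The [4,2] property: no four vertices spanning at most one edge. -/
def FourTwo (G : SimpleGraph V) : Prop :=
  ∀ a b c d : V, a ≠ b → a ≠ c → a ≠ d → b ≠ c → b ≠ d → c ≠ d →
    ¬ G.Adj a b → ¬ G.Adj a c → ¬ G.Adj b c → ¬ G.Adj a d → ¬ G.Adj b d → False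

theorem fourTwo_of [DecidableEq V] [DecidableRel G.Adj] (h : IsSTGraph G 4 2) : FourTwo G := by
  intro a b c d hab hac had hbc hbd hcd n1 n2 n3 n4 n5
  have h4 : ({a, b, c, d} : Finset V).card = 4 := by
    rw [Finset.card_eq_succ]
    refine ⟨a, {b, c, d}, by simp [*], rfl, ?_⟩
    rw [Finset.card_eq_three]
    exact ⟨b, c, d, hbc, hbd, hcd, rfl⟩
  have h5 := h _ h4
  unfold edgesWithin at h5
  have h6 : (({a, b, c, d} : Finset V).sym2.filter (· ∈ G.edgeSet)) ⊆ {s(c, d)} := by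
    intro e
    induction e using Sym2.ind with
    | _ x y =>
      simp only [Finset.mem_filter, Finset.mk_mem_sym2_iff, Finset.mem_insert,
        Finset.mem_singleton, SimpleGraph.mem_edgeSet]
      rintro ⟨⟨hx, hy⟩, hxy⟩
      rcases hx with rfl | rfl | rfl | rfl <;> rcases hy with rfl | rfl | rfl | rfl <;>
        first
        | exact (G.loopless.irrefl _ hxy).elim
        | exact (n1 hxy).elim | exact (n2 hxy).elim | exact (n3 hxy).elim
        | exact (n4 hxy).elim | exact (n5 hxy).elim
        | exact (n1 hxy.symm).elim | exact (n2 hxy.symm).elim | exact (n3 hxy.symm).elim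
        | exact (n4 hxy.symm).elim | exact (n5 hxy.symm).elim
        | rfl
        | exact Sym2.eq_swap
  have := Finset.card_le_card h6
  simp at this
  omega

theorem boundary [Fintype V] (h2 : TwoConnected G) (S : Set V) (v s t : V) (hs : s ∈ S)
    (ht : t ∉ S) (hsv : s ≠ v) (htv : t ≠ v) :
    ∃ a b, a ∈ S ∧ b ∉ S ∧ a ≠ v ∧ b ≠ v ∧ G.Adj a b := by
  obtain ⟨p⟩ := (h2.2 v).preconnected ⟨s, hsv⟩ ⟨t, htv⟩
  obtain ⟨d, -, h3, h4⟩ := p.exists_boundary_dart {x | x.1 ∈ S} hs ht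
  exact ⟨d.fst, d.snd, h3, h4, d.fst.2, d.snd.2, d.adj⟩

theorem two_of_three (H : FourTwo G) {a b c d : V} (hab : a ≠ b) (hac : a ≠ c) (hbc : b ≠ c)
    (n1 : ¬ G.Adj a b) (n2 : ¬ G.Adj a c) (n3 : ¬ G.Adj b c) (hda : d ≠ a) (hdb : d ≠ b)
    (hdc : d ≠ c) :
    (G.Adj d a ∧ G.Adj d b) ∨ (G.Adj d a ∧ G.Adj d c) ∨ (G.Adj d b ∧ G.Adj d c) := by
  have e1 := H a b c d hab hac hda.symm hbc hdb.symm hdc.symm n1 n2 n3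
  have e2 := H a c b d hac hab hda.symm hbc.symm hdc.symm hdb.symm n2 n1 (fun h => n3 h.symm)
  have e3 := H b c a d hbc hab.symm hdb.symm hac.symm hdc.symm hda.symm n3
    (fun h => n1 h.symm) (fun h => n2 h.symm)
  rw [G.adj_comm d a, G.adj_comm d b, G.adj_comm d c]
  tauto

theorem fresh [Fintype V] (L : List V) (h : L.length < Fintype.card V) : ∃ z, z ∉ L := by
  classical
  by_contra hc
  push Not at hc
  have h1 : (Finset.univ : Finset V) ⊆ L.toFinset := fun z _ => by simpa using hc z
  have h2 := Finset.card_le_card h1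
  have h3 := L.toFinset_card_le
  rw [Finset.card_univ] at h2
  omega

theorem cyc3 {a b c : V} (h1 : G.Adj a b) (h2 : G.Adj b c) (h3 : G.Adj c a) : HasCyc G 3 := by
  refine ⟨[a, b, c], a, c, ?_, ?_, h3, rfl⟩
  · simp [Seg, h1, h2]
  · simp [h1.ne, h2.ne, h3.ne.symm]

theorem cyc4 {a b c d : V} (h1 : G.Adj a b) (h2 : G.Adj b c) (h3 : G.Adj c d)
    (h4 : G.Adj d a) (n1 : a ≠ c) (n2 : b ≠ d) : HasCyc G 4 := by
  refine ⟨[a, b, c, d], a, d, ?_, ?_, h4, rfl⟩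
  · simp [Seg, h1, h2, h3]
  · simp [h1.ne, h2.ne, h3.ne, h4.ne.symm, n1, n2]

theorem cyc5 {a b c d e : V} (h1 : G.Adj a b) (h2 : G.Adj b c) (h3 : G.Adj c d)
    (h4 : G.Adj d e) (h5 : G.Adj e a) (n : [a, b, c, d, e].Nodup) : HasCyc G 5 :=
  ⟨[a, b, c, d, e], a, e, by simp [Seg, h1, h2, h3, h4], n, h5, rfl⟩

theorem no_indep [Fintype V] (H : FourTwo G) (hn : 7 ≤ Fintype.card V) (hno : ¬ HasCyc G 3)
    {a b c : V} (hab : a ≠ b) (hac : a ≠ c) (hbc : b ≠ c)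
    (n1 : ¬ G.Adj a b) (n2 : ¬ G.Adj a c) (n3 : ¬ G.Adj b c) : False := by
  have key : ∀ d e : V, d ∉ [a, b, c] → e ∉ [a, b, c] → ¬ G.Adj d e := by
    intro d e hd he hde
    simp only [List.mem_cons, List.not_mem_nil, or_false, not_or] at hd he
    have k1 := two_of_three H hab hac hbc n1 n2 n3 hd.1 hd.2.1 hd.2.2
    have k2 := two_of_three H hab hac hbc n1 n2 n3 he.1 he.2.1 he.2.2
    have t : ∀ z, G.Adj d z → G.Adj e z → False := fun z h1 h2 => hno (cyc3 hde h2 h1.symm)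
    have := t a
    have := t b
    have := t c
    tauto
  obtain ⟨d1, h1⟩ := fresh [a, b, c] (by simp; omega)
  obtain ⟨d2, h2⟩ := fresh (d1 :: [a, b, c]) (by simp; omega)
  obtain ⟨d3, h3⟩ := fresh (d2 :: d1 :: [a, b, c]) (by simp; omega)
  obtain ⟨d4, h4⟩ := fresh (d3 :: d2 :: d1 :: [a, b, c]) (by simp; omega)
  have m2 : d2 ∉ [a, b, c] := fun h => h2 (List.mem_cons_of_mem _ h)
  have m3 : d3 ∉ [a, b, c] := fun h =>
    h3 (List.mem_cons_of_mem _ (List.mem_cons_of_mem _ h))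
  have m4 : d4 ∉ [a, b, c] := fun h =>
    h4 (List.mem_cons_of_mem _ (List.mem_cons_of_mem _ (List.mem_cons_of_mem _ h)))
  simp only [List.mem_cons, not_or] at h2 h3 h4
  exact H d1 d2 d3 d4 (Ne.symm h2.1) (Ne.symm h3.2.1) (Ne.symm h4.2.2.1) (Ne.symm h3.1)
    (Ne.symm h4.2.1) (Ne.symm h4.1) (key _ _ h1 m2) (key _ _ h1 m3) (key _ _ m2 m3)
    (key _ _ h1 m4) (key _ _ m2 m4)

theorem exists_tri [Fintype V] (H : FourTwo G) (hn : 7 ≤ Fintype.card V) : HasCyc G 3 := by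
  by_contra hno
  have t1 : ∀ a b c : V, G.Adj a b → G.Adj b c → G.Adj a c → False :=
    fun a b c h1 h2 h3 => hno (cyc3 h1 h2 h3.symm)
  have t2 : ∀ a b c : V, a ≠ b → a ≠ c → b ≠ c → ¬ G.Adj a b → ¬ G.Adj a c → ¬ G.Adj b c →
    False := fun a b c => no_indep H hn hno
  obtain ⟨v, -⟩ := fresh ([] : List V) (by simp; omega)
  obtain ⟨d1, h1⟩ := fresh [v] (by simp; omega)
  obtain ⟨d2, h2⟩ := fresh (d1 :: [v]) (by simp; omega)
  obtain ⟨d3, h3⟩ := fresh (d2 :: d1 :: [v]) (by simp; omega)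
  obtain ⟨d4, h4⟩ := fresh (d3 :: d2 :: d1 :: [v]) (by simp; omega)
  obtain ⟨d5, h5⟩ := fresh (d4 :: d3 :: d2 :: d1 :: [v]) (by simp; omega)
  simp only [List.mem_cons, not_or, List.not_mem_nil, not_false_eq_true, and_true] at h1 h2 h3 h4 h5
  have s1 : ∀ x y z : V, x ≠ y → x ≠ z → y ≠ z → G.Adj v x → G.Adj v y → G.Adj v z → False := by
    intro x y z a1 a2 a3 b1 b2 b3
    exact t2 x y z a1 a2 a3 (fun h => t1 v x y b1 h b2) (fun h => t1 v x z b1 h b3)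
      (fun h => t1 v y z b2 h b3)
  have s2 : ∀ x y z : V, x ≠ y → x ≠ z → y ≠ z → x ≠ v → y ≠ v → z ≠ v →
      ¬ G.Adj v x → ¬ G.Adj v y → ¬ G.Adj v z → False := by
    intro x y z a1 a2 a3 c1 c2 c3 b1 b2 b3
    have u : ∀ p q, p ≠ q → p ≠ v → q ≠ v → ¬ G.Adj v p → ¬ G.Adj v q → G.Adj p q :=
      fun p q e1 e2 e3 e4 e5 => by
        by_contra e6
        exact t2 v p q e2.symm e3.symm e1 e4 e5 e6
    exact t1 x y z (u _ _ a1 c1 c2 b1 b2) (u _ _ a3 c2 c3 b2 b3) (u _ _ a2 c1 c3 b1 b3)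
  by_cases q1 : G.Adj v d1 <;> by_cases q2 : G.Adj v d2 <;> by_cases q3 : G.Adj v d3 <;>
    by_cases q4 : G.Adj v d4 <;> by_cases q5 : G.Adj v d5 <;> grind

theorem cyc4_of_cyc3 [Fintype V] (H : FourTwo G) (hn : 7 ≤ Fintype.card V) (h3 : HasCyc G 3) :
    HasCyc G 4 := by
  by_contra hno
  obtain ⟨L, a, b, hs, hnd, hab, hl⟩ := h3
  obtain ⟨u, w, t, rfl⟩ := List.length_eq_three.1 hl
  have huw : G.Adj u w := by have := hs.1; simp at this; exact this.1
  have hwt : G.Adj w t := by have := hs.1; simp at this; exact this.2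
  have htu : G.Adj t u := by
    have h1 := hs.2.1
    have h2 := hs.2.2
    simp at h1 h2
    rwa [h1, h2]
  -- vertices outside the triangle have at most one neighbour on it
  have o1 : ∀ z p q r : V, G.Adj p q → G.Adj q r → G.Adj r p → z ≠ r → G.Adj z p → G.Adj z q →
      False := fun z p q r h1 h2 h3 h0 h4 h5 =>
    hno (cyc4 h4 h3.symm h2.symm h5.symm h0 h1.ne)
  have nonadj : ∀ p q r z1 z2 : V, G.Adj p q → G.Adj q r → G.Adj r p → z1 ∉ [p, q, r] →
      z2 ∉ [p, q, r] → z1 ≠ z2 → ¬ G.Adj z1 z2 → G.Adj z1 p → G.Adj z2 q → False := by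
    intro p q r z1 z2 h1 h2 h3 m1 m2 hz n k1 k2
    simp only [List.mem_cons, List.not_mem_nil, or_false, not_or] at m1 m2
    have f1 : ¬ G.Adj z1 r := fun h => o1 z1 r p q h3 h1 h2 m1.2.1 h k1
    have f2 : ¬ G.Adj z2 r := fun h => o1 z2 q r p h2 h3 h1 m2.1 k2 h
    obtain ⟨x, hx⟩ := fresh [p, q, r, z1, z2] (by simp; omega)
    obtain ⟨y, hy⟩ := fresh [p, q, r, z1, z2, x] (by simp; omega)
    simp only [List.mem_cons, List.not_mem_nil, or_false, not_or] at hx hy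
    have g : ∀ x : V, x ≠ p → x ≠ q → x ≠ r → x ≠ z1 → x ≠ z2 → G.Adj x z1 ∧ G.Adj x z2 := by
      intro x e1 e2 e3 e4 e5
      have e := two_of_three H hz m1.2.2 m2.2.2 n f1 f2 e4 e5 e3
      by_contra hcon
      have e6 : G.Adj x r := by tauto
      have e7 : G.Adj x z1 ∨ G.Adj x z2 := by tauto
      rcases e7 with e7 | e7
      · exact hno (cyc4 e7 k1 h3.symm e6.symm e1 m1.2.2)
      · exact hno (cyc4 e7 k2 h2 e6.symm e2 m2.2.2)
    have gx := g x hx.1 hx.2.1 hx.2.2.1 hx.2.2.2.1 hx.2.2.2.2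
    have gy := g y hy.1 hy.2.1 hy.2.2.1 hy.2.2.2.1 hy.2.2.2.2.1
    exact hno (cyc4 gx.1 gy.1.symm gy.2 gx.2.symm (Ne.symm hy.2.2.2.2.2) hz)
  have adj : ∀ z1 z2 : V, z1 ∉ [u, w, t] → z2 ∉ [u, w, t] → z1 ≠ z2 → G.Adj z1 z2 := by
    intro z1 z2 m1 m2 hz
    by_contra n
    have n' : ¬ G.Adj z2 z1 := fun h => n h.symm
    have m1a : z1 ∉ [w, t, u] := by simp at m1 ⊢; tauto
    have m1b : z1 ∉ [t, u, w] := by simp at m1 ⊢; tauto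
    have m2a : z2 ∉ [w, t, u] := by simp at m2 ⊢; tauto
    have m2b : z2 ∉ [t, u, w] := by simp at m2 ⊢; tauto
    have A1 := nonadj u w t z1 z2 huw hwt htu m1 m2 hz n
    have A2 := nonadj u w t z2 z1 huw hwt htu m2 m1 hz.symm n'
    have A3 := nonadj w t u z1 z2 hwt htu huw m1a m2a hz n
    have A4 := nonadj w t u z2 z1 hwt htu huw m2a m1a hz.symm n'
    have A5 := nonadj t u w z1 z2 htu huw hwt m1b m2b hz n
    have A6 := nonadj t u w z2 z1 htu huw hwt m2b m1b hz.symm n'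
    simp only [List.mem_cons, List.not_mem_nil, or_false, not_or] at m1 m2
    have B1 := o1 z1 u w t huw hwt htu m1.2.2
    have B2 := o1 z1 w t u hwt htu huw m1.1
    have B3 := o1 z1 t u w htu huw hwt m1.2.1
    have B4 := o1 z2 u w t huw hwt htu m2.2.2
    have B5 := o1 z2 w t u hwt htu huw m2.1
    have B6 := o1 z2 t u w htu huw hwt m2.2.1
    have C1 := H z1 z2 u w hz m1.1 m1.2.1 m2.1 m2.2.1 huw.ne n
    have C2 := H z1 z2 w t hz m1.2.1 m1.2.2 m2.2.1 m2.2.2 hwt.ne n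
    have C3 := H z1 z2 t u hz m1.2.2 m1.1 m2.2.2 m2.1 htu.ne n
    by_cases a : G.Adj z1 u
    · exact C2 (B1 a) (A1 a) (fun h => B3 h a) (fun h => A6 h a)
    by_cases b : G.Adj z1 w
    · exact C3 (B2 b) (A3 b) (fun h => B1 h b) (fun h => A2 h b)
    by_cases c : G.Adj z1 t
    · exact C1 (B3 c) (A5 c) (fun h => B2 h c) (fun h => A4 h c)
    by_cases d : G.Adj z2 u
    · exact C2 b (B4 d) c (fun h => B6 h d)
    by_cases e : G.Adj z2 w
    · exact C3 c (B5 e) a d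
    exact C1 a d b e
  obtain ⟨d1, h1⟩ := fresh [u, w, t] (by simp; omega)
  obtain ⟨d2, h2⟩ := fresh (d1 :: [u, w, t]) (by simp; omega)
  obtain ⟨d3, h3⟩ := fresh (d2 :: d1 :: [u, w, t]) (by simp; omega)
  obtain ⟨d4, h4⟩ := fresh (d3 :: d2 :: d1 :: [u, w, t]) (by simp; omega)
  have m2 : d2 ∉ [u, w, t] := fun h => h2 (List.mem_cons_of_mem _ h)
  have m3 : d3 ∉ [u, w, t] := fun h =>
    h3 (List.mem_cons_of_mem _ (List.mem_cons_of_mem _ h))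
  have m4 : d4 ∉ [u, w, t] := fun h =>
    h4 (List.mem_cons_of_mem _ (List.mem_cons_of_mem _ (List.mem_cons_of_mem _ h)))
  simp only [List.mem_cons, not_or] at h2 h3 h4
  exact hno (cyc4 (adj _ _ h1 m2 (Ne.symm h2.1)) (adj _ _ m2 m3 (Ne.symm h3.1))
    (adj _ _ m3 m4 (Ne.symm h4.1)) (adj _ _ m4 h1 h4.2.2.1) (Ne.symm h3.2.1) (Ne.symm h4.2.1))

/-- All perms used below are checked by counting. -/
theorem ext_facts {A B : List V} {a a' b b' p q x : V} (hA : Seg G A a a') (hB : Seg G B b b')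
    (hnd : (x :: p :: q :: (A ++ B)).Nodup) (hpa : G.Adj p a) (haq : G.Adj a' q)
    (hqb : G.Adj q b) (hbp : G.Adj b' p) (hxp : G.Adj x p) (hxq : G.Adj x q)
    (hno : ¬ HasCyc G (A.length + B.length + 3)) :
    ¬ G.Adj x a ∧ ¬ G.Adj x a' ∧ ¬ G.Adj x b ∧ ¬ G.Adj x b' ∧ ¬ G.Adj a b ∧ ¬ G.Adj a' b' := by
  classical
  have hl : (x :: p :: q :: (A ++ B)).length = A.length + B.length + 3 := by simp
  refine ⟨?_, ?_, ?_, ?_, ?_, ?_⟩ <;> intro h <;> apply hno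
  · refine HasCyc.mk (((Seg.cons hxp.symm (Seg.cons h hA)).append (Seg.cons hqb hB) haq)) hbp ?_
      hnd hl
    rw [List.perm_iff_count]; intro z
    simp only [List.count_cons, List.count_append, List.count_reverse, List.count_nil]; ring
  · refine HasCyc.mk (((Seg.cons hpa hA).append (Seg.cons hxq (Seg.cons hqb hB)) h.symm)) hbp ?_
      hnd hl
    rw [List.perm_iff_count]; intro z
    simp only [List.count_cons, List.count_append, List.count_reverse, List.count_nil]; ring
  · refine HasCyc.mk (((Seg.cons hpa hA).append (Seg.cons hxq.symm (Seg.cons h hB)) haq)) hbp ?_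
      hnd hl
    rw [List.perm_iff_count]; intro z
    simp only [List.count_cons, List.count_append, List.count_reverse, List.count_nil]; ring
  · refine HasCyc.mk (((Seg.cons hxp (Seg.cons hpa hA)).append (Seg.cons hqb hB) haq)) h.symm ?_
      hnd hl
    rw [List.perm_iff_count]; intro z
    simp only [List.count_cons, List.count_append, List.count_reverse, List.count_nil]; ring
  · refine HasCyc.mk ((Seg.cons hxp (Seg.cons hbp.symm hB.rev)).append
      (hA.append (Seg.single q) haq) h.symm) hxq.symm ?_ hnd hl
    rw [List.perm_iff_count]; intro z
    simp only [List.count_cons, List.count_append, List.count_reverse, List.count_nil]; ring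
  · refine HasCyc.mk ((Seg.cons hxp (Seg.cons hpa hA)).append
      (hB.rev.append (Seg.single q) hqb.symm) h) hxq.symm ?_ hnd hl
    rw [List.perm_iff_count]; intro z
    simp only [List.count_cons, List.count_append, List.count_reverse, List.count_nil]; ring

theorem ext_short (H : FourTwo G) {B : List V} {a b b' p q x : V} (hB : Seg G B b b')
    (hnd : (x :: p :: q :: ([a] ++ B)).Nodup) (hpa : G.Adj p a) (haq : G.Adj a q)
    (hqb : G.Adj q b) (hbp : G.Adj b' p) (hxp : G.Adj x p) (hxq : G.Adj x q)
    (hno : ¬ HasCyc G (B.length + 4)) (hbb : b ≠ b') : False := by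
  have hno' : ¬ HasCyc G ([a].length + B.length + 3) := by
    convert hno using 2; simp; omega
  obtain ⟨f1, f2, f3, f4, f5, f6⟩ := ext_facts (Seg.single a) hB hnd hpa haq hqb hbp hxp hxq hno'
  have m1 := hB.mem_left
  have m2 := hB.mem_right
  have e1 : x ≠ a := by rintro rfl; simp at hnd
  have e2 : x ≠ b := by rintro rfl; simp_all
  have e3 : x ≠ b' := by rintro rfl; simp_all
  have e4 : a ≠ b := by rintro rfl; simp_all
  have e5 : a ≠ b' := by rintro rfl; simp_all
  exact H x a b b' e1 e2 e3 e4 e5 hbb f1 f3 f5 f4 f6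

theorem ext_k23 [Fintype V] (H : FourTwo G) (hn : 7 ≤ Fintype.card V) {a b p q x : V}
    (hnd : [x, p, q, a, b].Nodup) (hpa : G.Adj p a) (haq : G.Adj a q)
    (hqb : G.Adj q b) (hbp : G.Adj b p) (hxp : G.Adj x p) (hxq : G.Adj x q)
    (hno : ¬ HasCyc G 5) : False := by
  obtain ⟨f1, f2, f3, f4, f5, f6⟩ := ext_facts (Seg.single a) (Seg.single b) (by simpa using hnd)
    hpa haq hqb hbp hxp hxq (by simpa using hno)
  obtain ⟨y, hy⟩ := fresh [x, p, q, a, b] (by simp; omega)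
  obtain ⟨z, hz⟩ := fresh [x, p, q, a, b, y] (by simp; omega)
  simp only [List.mem_cons, List.not_mem_nil, or_false, not_or, List.nodup_cons,
    not_false_eq_true, List.nodup_nil, and_true] at hy hz hnd
  obtain ⟨⟨d1, d2, d3, d4⟩, ⟨d5, d6, d7⟩, ⟨d8, d9⟩, d10⟩ := hnd
  -- symmetric description
  have S : ∀ y, y ≠ x → y ≠ p → y ≠ q → y ≠ a → y ≠ b →
      ∃ r s, r ≠ s ∧ G.Adj y r ∧ G.Adj y s ∧ (r = x ∨ r = a ∨ r = b) ∧ (s = x ∨ s = a ∨ s = b) := by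
    intro y h1 h2 h3 h4 h5
    rcases two_of_three H d3 d4 d10 f1 f3 f5 h1 h4 h5 with h | h | h
    · exact ⟨x, a, d3, h.1, h.2, by simp, by simp⟩
    · exact ⟨x, b, d4, h.1, h.2, by simp, by simp⟩
    · exact ⟨a, b, d10, h.1, h.2, by simp, by simp⟩
  have P : ∀ r, (r = x ∨ r = a ∨ r = b) → G.Adj p r ∧ G.Adj q r := by
    rintro r (rfl | rfl | rfl)
    · exact ⟨hxp.symm, hxq.symm⟩
    · exact ⟨hpa, haq.symm⟩
    · exact ⟨hbp.symm, hqb⟩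
  have T : ∀ r, (r = x ∨ r = a ∨ r = b) → ∃ s, (s = x ∨ s = a ∨ s = b) ∧ r ≠ s := by
    rintro r (rfl | rfl | rfl)
    · exact ⟨a, by simp, d3⟩
    · exact ⟨x, by simp, Ne.symm d3⟩
    · exact ⟨x, by simp, Ne.symm d4⟩
  have npq : ¬ G.Adj p q := by
    intro h
    obtain ⟨r, s, e1, e2, e3, e4, e5⟩ := S y hy.1 hy.2.1 hy.2.2.1 hy.2.2.2.1 hy.2.2.2.2
    have := P r e4
    have := P s e5
    apply hno
    refine cyc5 e3 (P s e5).1.symm h (P r e4).2 e2.symm ?_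
    grind
  have np : ∀ y, y ≠ x → y ≠ p → y ≠ q → y ≠ a → y ≠ b → ¬ G.Adj y p ∧ ¬ G.Adj y q := by
    intro y h1 h2 h3 h4 h5
    obtain ⟨r, s, e1, e2, e3, e4, e5⟩ := S y h1 h2 h3 h4 h5
    obtain ⟨s', g1, g2⟩ := T r e4
    constructor <;> intro h <;> apply hno
    · refine cyc5 h (P s' g1).1 (P s' g1).2.symm (P r e4).2 e2.symm ?_
      grind
    · refine cyc5 h (P s' g1).2 (P s' g1).1.symm (P r e4).1 e2.symm ?_
      grind
  have ny := np y hy.1 hy.2.1 hy.2.2.1 hy.2.2.2.1 hy.2.2.2.2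
  have nz := np z hz.1 hz.2.1 hz.2.2.1 hz.2.2.2.1 hz.2.2.2.2.1
  have nyz : ¬ G.Adj y z := by
    intro h
    obtain ⟨r, s, e1, e2, e3, e4, e5⟩ := S y hy.1 hy.2.1 hy.2.2.1 hy.2.2.2.1 hy.2.2.2.2
    obtain ⟨r', s', e1', e2', e3', e4', e5'⟩ :=
      S z hz.1 hz.2.1 hz.2.2.1 hz.2.2.2.1 hz.2.2.2.2.1
    have : ∃ t, (t = x ∨ t = a ∨ t = b) ∧ G.Adj z t ∧ t ≠ r := by
      by_cases hr : r' = r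
      · exact ⟨s', e5', e3', by rw [← hr]; exact e1'.symm⟩
      · exact ⟨r', e4', e2', hr⟩
    obtain ⟨t, t1, t2, t3⟩ := this
    apply hno
    refine cyc5 h t2 (P t t1).1.symm (P r e4).1 e2.symm ?_
    grind
  exact H p q y z d5 (Ne.symm hy.2.1) (Ne.symm hz.2.1) (Ne.symm hy.2.2.1) (Ne.symm hz.2.2.1)
    (Ne.symm hz.2.2.2.2.2) npq (fun h => ny.1 h.symm) (fun h => ny.2 h.symm)
    (fun h => nz.1 h.symm) (fun h => nz.2 h.symm)

theorem ext_main [Fintype V] (H : FourTwo G) (hn : 7 ≤ Fintype.card V)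
    {A B : List V} {a a' b b' p q x : V} (hA : Seg G A a a') (hB : Seg G B b b')
    (hnd : (x :: p :: q :: (A ++ B)).Nodup) (hpa : G.Adj p a) (haq : G.Adj a' q)
    (hqb : G.Adj q b) (hbp : G.Adj b' p) (hxp : G.Adj x p) (hxq : G.Adj x q)
    (hno : ¬ HasCyc G (A.length + B.length + 3)) : False := by
  classical
  have hnA : A.Nodup := by
    simp only [List.nodup_cons, List.nodup_append] at hnd; tauto
  have hnB : B.Nodup := by
    simp only [List.nodup_cons, List.nodup_append] at hnd; tauto
  rcases hA.split hnA with ⟨rfl, rfl⟩ | ⟨haa, a2, A', rfl, hA', haa2⟩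
  · rcases hB.split hnB with ⟨rfl, rfl⟩ | ⟨hbb, -⟩
    · exact ext_k23 H hn (by simpa using hnd) hpa haq hqb hbp hxp hxq hno
    · refine ext_short H hB hnd hpa haq hqb hbp hxp hxq ?_ hbb
      convert hno using 2; simp; omega
  · rcases hB.split hnB with ⟨rfl, rfl⟩ | ⟨hbb, -⟩
    · refine ext_short H hA (x := x) (a := b) (p := q) (q := p) ?_ hqb hbp hpa haq hxq hxp ?_ haa
      · refine (List.Perm.nodup_iff ?_).2 hnd
        rw [List.perm_iff_count]; intro z
        simp only [List.count_cons, List.count_append, List.count_reverse, List.count_nil]; ring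
      · convert hno using 2
        simp only [List.length_cons, List.length_nil] <;> omega
    · obtain ⟨f1, f2, f3, f4, f5, f6⟩ := ext_facts hA hB hnd hpa haq hqb hbp hxp hxq hno
      have hnd' : (x :: p :: a2 :: ([a] ++ (A'.tail ++ q :: B))).Nodup ∧ A' = a2 :: A'.tail := by
        have h0 : A' = a2 :: A'.tail := by
          have := hA'.2.1
          cases A' <;> simp_all
        refine ⟨?_, h0⟩
        refine (List.Perm.nodup_iff ?_).2 hnd
        rw [h0, List.perm_iff_count]; intro z
        simp only [List.count_cons, List.count_append, List.count_reverse, List.count_nil,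
          List.tail_cons]; ring
      obtain ⟨hnd', hA2⟩ := hnd'
      have mb := hB.mem_left
      have mb' := hB.mem_right
      have ma2 := hA'.mem_left
      have ma' := hA'.mem_right
      have d1 : x ≠ a := by rintro rfl; simp at hnd
      have d2 : x ≠ b := by rintro rfl; simp only [List.nodup_cons, List.nodup_append] at hnd <;> grind
      have d3 : x ≠ b' := by rintro rfl; simp only [List.nodup_cons, List.nodup_append] at hnd <;> grind
      have d4 : a ≠ b := by rintro rfl; simp only [List.nodup_cons, List.nodup_append] at hnd <;> grind
      have d5 : a ≠ b' := by rintro rfl; simp only [List.nodup_cons, List.nodup_append] at hnd <;> grind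
      have d6 : x ≠ a2 := by rintro rfl; simp only [List.nodup_cons, List.nodup_append] at hnd <;> grind
      have d7 : a ≠ a2 := haa2.ne
      have d8 : a2 ≠ b := by
        rintro rfl
        simp only [List.nodup_cons, List.nodup_append] at hnd <;> grind
      have hlen : A'.length = A'.tail.length + 1 := by
        conv_lhs => rw [hA2]
        simp
      -- `a2` is not adjacent to `x`
      have n2 : ¬ G.Adj x a2 := by
        intro hxa2
        have hS : ∃ c, Seg G (A'.tail ++ q :: B) c b' ∧ G.Adj a2 c ∧ c ≠ b' := by
          have hnA' : A'.Nodup := (List.nodup_cons.1 hnA).2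
          rcases hA'.split hnA' with ⟨r1, r2⟩ | ⟨r1, c, A'', r2, r3, r4⟩
          · refine ⟨q, ?_, r1 ▸ haq, ?_⟩
            · rw [r2]; simpa using Seg.cons hqb hB
            · rintro rfl; simp only [List.nodup_cons, List.nodup_append] at hnd <;> grind
          · refine ⟨c, ?_, r4, ?_⟩
            · rw [r2]; exact r3.append (Seg.cons hqb hB) haq
            · have := r3.mem_left
              rintro rfl
              rw [r2] at hnd
              simp only [List.nodup_cons, List.nodup_append] at hnd <;> grind
        obtain ⟨c, c1, c2, c3⟩ := hS
        refine ext_short H c1 hnd' hpa haa2 c2 hbp hxp hxa2 ?_ c3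
        convert hno using 2
        simp; omega
      have k1 := two_of_three H d1 d2 d4 f1 f3 f5 d6.symm d7.symm d8
      have k2 := two_of_three H d1 d2 d4 f1 f3 f5 d3.symm d5.symm hbb.symm
      have g1 : G.Adj a2 b := by
        have : ¬ G.Adj a2 x := fun h => n2 h.symm
        tauto
      have g2 : G.Adj b' a := by
        have : ¬ G.Adj b' x := fun h => f4 h.symm
        tauto
      apply hno
      refine HasCyc.mk ((Seg.cons hxq (Seg.cons haq.symm hA'.rev)).append
        (hB.append (Seg.cons hpa.symm (Seg.single p)) g2) g1) hxp.symm ?_ hnd (by simp; omega)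
      rw [List.perm_iff_count]; intro z
      simp only [List.count_cons, List.count_append, List.count_reverse, List.count_nil]; ring

/-- a vertex outside a cycle with two neighbours on it yields a longer cycle -/
theorem ext_cyc [Fintype V] (H : FourTwo G) (hn : 7 ≤ Fintype.card V)
    {L : List V} {a b p q x : V} (h : Seg G L a b) (hab : G.Adj b a) (hL : L.Nodup)
    (hp : p ∈ L) (hq : q ∈ L) (hpq : p ≠ q) (hx : x ∉ L) (hxp : G.Adj x p) (hxq : G.Adj x q) 
    (hl : 3 ≤ L.length) : HasCyc G (L.length + 1) := by
  classical
  by_contra hno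
  obtain ⟨A, B, hA, hB, hperm⟩ := cyc_decomp h hab hp hq hpq
  have hlen := hperm.length_eq
  simp only [List.length_cons, List.length_append] at hlen
  have hnd : (x :: p :: q :: (A ++ B)).Nodup := by
    rw [List.nodup_cons]
    exact ⟨fun h => hx (hperm.mem_iff.1 h), hperm.nodup_iff.2 hL⟩
  rcases hA with ⟨rfl, hA⟩ | ⟨a, a', hA, hpa, haq⟩
  · rcases hB with ⟨rfl, hB⟩ | ⟨b, b', hB, hqb, hbp⟩
    · simp at hlen; omega
    · refine hno (HasCyc.mk (Seg.cons hxp.symm (Seg.cons hxq (Seg.cons hqb hB))) hbp ?_ hnd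
        (by simpa using hlen))
      rw [List.perm_iff_count]; intro z
      simp only [List.count_cons, List.count_append, List.count_reverse, List.count_nil]; ring
  · rcases hB with ⟨rfl, hB⟩ | ⟨b, b', hB, hqb, hbp⟩
    · refine hno (HasCyc.mk (Seg.cons hxq.symm (Seg.cons hxp (Seg.cons hpa hA))) haq ?_ hnd
        (by simpa using hlen))
      rw [List.perm_iff_count]; intro z
      simp only [List.count_cons, List.count_append, List.count_reverse, List.count_nil]; ring
    · refine ext_main H hn hA hB hnd hpa haq hqb hbp hxp hxq ?_
      convert hno using 2
      omega

theorem freshL {L : List V} (hL : L.Nodup) (M : List V) (h : M.length < L.length) :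
    ∃ c ∈ L, c ∉ M := by
  classical
  by_contra hc
  push Not at hc
  have h1 : L.toFinset ⊆ M.toFinset := fun z hz => by
    simp only [List.mem_toFinset] at hz ⊢
    exact hc z hz
  have h2 := Finset.card_le_card h1
  have h3 := M.toFinset_card_le
  rw [List.toFinset_card_of_nodup hL] at h2
  omega

theorem clique_seg {K : List V} (hK : K.Nodup) (hc : ∀ c ∈ K, ∀ d ∈ K, c ≠ d → G.Adj c d)
    {p q : V} (hp : p ∈ K) (hq : q ∈ K) (hpq : p ≠ q) (m : ℕ) (hm : m + 2 ≤ K.length) :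
    ∃ M, Seg G (p :: (M ++ [q])) p q ∧ (p :: (M ++ [q])).Nodup ∧ (∀ c ∈ p :: (M ++ [q]), c ∈ K) ∧
      M.length = m := by
  classical
  have hq' : q ∈ K.erase p := (List.mem_erase_of_ne hpq.symm).2 hq
  have h1 : (K.erase p).Nodup := hK.erase p
  have h2 : ((K.erase p).erase q).Nodup := h1.erase q
  have l1 : (K.erase p).length = K.length - 1 := List.length_erase_of_mem hp
  have l2 : ((K.erase p).erase q).length = (K.erase p).length - 1 := List.length_erase_of_mem hq'
  have hsub : ∀ c ∈ ((K.erase p).erase q).take m, c ∈ K ∧ c ≠ p ∧ c ≠ q := by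
    intro c hcm
    have := List.mem_of_mem_take hcm
    rw [h1.mem_erase_iff, hK.mem_erase_iff] at this
    tauto
  have hnd : (p :: (((K.erase p).erase q).take m ++ [q])).Nodup := by
    rw [List.nodup_cons, List.nodup_append]
    refine ⟨?_, h2.sublist (List.take_sublist _ _), by simp, ?_⟩
    · simp only [List.mem_append, List.mem_singleton, not_or]
      exact ⟨fun h => (hsub _ h).2.1 rfl, hpq⟩
    · intro c hc1 d hd
      simp only [List.mem_singleton] at hd
      rw [hd]
      exact (hsub _ hc1).2.2
  have hmem : ∀ c ∈ p :: (((K.erase p).erase q).take m ++ [q]), c ∈ K := by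
    intro c hc1
    simp only [List.mem_cons, List.mem_append, List.not_mem_nil, or_false] at hc1
    rcases hc1 with rfl | h | rfl
    · exact hp
    · exact (hsub _ h).1
    · exact hq
  refine ⟨_, ⟨?_, by simp, ?_⟩, hnd, hmem, ?_⟩
  · apply List.Pairwise.isChain
    exact List.Pairwise.imp_of_mem (fun {c d} e1 e2 e3 => hc c (hmem c e1) d (hmem d e2) e3) hnd
  · rw [← List.cons_append, List.getLast?_append]; simp
  · simp; omega

theorem step [Fintype V] (h2 : TwoConnected G) (H : FourTwo G) (hn : 7 ≤ Fintype.card V)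
    {k : ℕ} (hk : 4 ≤ k) (hkn : k < Fintype.card V) (hc : HasCyc G k) : HasCyc G (k + 1) := by
  classical
  by_contra hno
  obtain ⟨L, a, b, hs, hnd, hab, hl⟩ := hc
  have O1 : ∀ x p q : V, x ∉ L → p ∈ L → q ∈ L → G.Adj x p → G.Adj x q → p = q := by
    intro x p q hx hp hq hxp hxq
    by_contra hpq
    have := ext_cyc H hn hs hab hnd hp hq hpq hx hxp hxq (by omega)
    rw [hl] at this
    exact hno this
  have miss : ∀ x, x ∉ L → ∃ u, ∀ c ∈ L, c ≠ u → ¬ G.Adj x c := by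
    intro x hx
    by_cases h : ∃ u ∈ L, G.Adj x u
    · obtain ⟨u, hu, hxu⟩ := h
      exact ⟨u, fun c hcL hcu hxc => hcu (O1 x c u hx hcL hu hxc hxu)⟩
    · push Not at h
      exact ⟨x, fun c hcL _ => h c hcL⟩
  have adjO : ∀ x y, x ∉ L → y ∉ L → x ≠ y → G.Adj x y := by
    intro x y hx hy hxy
    by_contra hnxy
    obtain ⟨u, hu⟩ := miss x hx
    obtain ⟨w, hw⟩ := miss y hy
    obtain ⟨c, c1, c2⟩ := freshL hnd [u, w] (by simp; omega)
    obtain ⟨d, d1, d2⟩ := freshL hnd [u, w, c] (by simp; omega)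
    simp only [List.mem_cons, List.not_mem_nil, or_false, not_or] at c2 d2
    have nx : ∀ z ∈ L, x ≠ z := by rintro z hz rfl; exact hx hz
    have ny : ∀ z ∈ L, y ≠ z := by rintro z hz rfl; exact hy hz
    exact H x y c d hxy (nx c c1) (nx d d1) (ny c c1) (ny d d1) (Ne.symm d2.2.2) hnxy
      (hu c c1 c2.1) (hw c c1 c2.2) (hu d d1 d2.1) (hw d d1 d2.2.1)
  obtain ⟨z0, hz0⟩ := fresh L (by omega)
  obtain ⟨c0, c01, -⟩ := freshL hnd [] (by simp; omega)
  obtain ⟨c1, c11, c12⟩ := freshL hnd [c0] (by simp; omega)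
  simp only [List.mem_singleton] at c12
  obtain ⟨x, u, hx, hu, -, -, hxu⟩ := boundary h2 {z | z ∉ L} c0 z0 c1 hz0 (by simpa using c11)
    (by rintro rfl; exact hz0 c01) c12
  have ht : ∃ t ∈ L, t ≠ u := by
    by_cases h : c0 = u
    · exact ⟨c1, c11, h ▸ c12⟩
    · exact ⟨c0, c01, h⟩
  obtain ⟨t, t1, t2⟩ := ht
  simp only [Set.mem_ofPred_eq, not_not] at hx hu
  obtain ⟨y, w, hy, hw, -, hwu, hyw⟩ := boundary h2 {z | z ∉ L} u z0 t hz0 (by simpa using t1)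
    (by rintro rfl; exact hz0 hu) t2
  simp only [Set.mem_ofPred_eq, not_not] at hy hw
  have hxy : x ≠ y := by
    rintro rfl
    exact hwu (O1 x w u hx hw hu hyw hxu)
  have axy := adjO x y hx hy hxy
  obtain ⟨A, B, hA, hB, hperm⟩ := cyc_decomp hs hab hu hw (Ne.symm hwu)
  have hnd2 := hperm.nodup_iff.2 hnd
  have hlen := hperm.length_eq
  simp only [List.length_cons, List.length_append, hl] at hlen
  have hAB : (A ++ B).Nodup := by
    simp only [List.nodup_cons] at hnd2; exact hnd2.2.2
  have hKL : ∀ c ∈ A ++ B, c ∈ L ∧ c ≠ u ∧ c ≠ w := by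
    intro c hc
    refine ⟨hperm.mem_iff.1 (List.mem_cons_of_mem _ (List.mem_cons_of_mem _ hc)), ?_, ?_⟩
    · rintro rfl
      simp only [List.nodup_cons] at hnd2
      exact hnd2.1 (List.mem_cons_of_mem _ hc)
    · rintro rfl
      simp only [List.nodup_cons] at hnd2
      exact hnd2.2.1 hc
  have nx : ∀ z ∈ L, x ≠ z := by rintro z hz rfl; exact hx hz
  have ny : ∀ z ∈ L, y ≠ z := by rintro z hz rfl; exact hy hz
  have clq : ∀ c ∈ A ++ B, ∀ d ∈ A ++ B, c ≠ d → G.Adj c d := by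
    intro c hc d hd hcd
    by_contra hncd
    obtain ⟨e1, e2, e3⟩ := hKL c hc
    obtain ⟨f1, f2, f3⟩ := hKL d hd
    exact H c d x y hcd (nx c e1).symm (ny c e1).symm (nx d f1).symm (ny d f1).symm hxy hncd
      (fun h => e2 (O1 x c u hx e1 hu h.symm hxu)) (fun h => f2 (O1 x d u hx f1 hu h.symm hxu))
      (fun h => e3 (O1 y c w hy e1 hw h.symm hyw)) (fun h => f3 (O1 y d w hy f1 hw h.symm hyw))
  by_cases hk4 : k = 4
  · subst hk4
    have huw : ¬ G.Adj u w := by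
      intro huw
      obtain ⟨z, hz⟩ := fresh (x :: y :: L) (by simp; omega)
      simp only [List.mem_cons, not_or] at hz
      refine hno (cyc5 hxu.symm (adjO x z hx hz.2.2 (Ne.symm hz.1))
        (adjO z y hz.2.2 hy hz.2.1) hyw huw.symm ?_)
      have n1 := nx u hu
      have n2 := nx w hw
      have n3 := ny u hu
      have n4 := ny w hw
      have n5 : z ≠ u := by rintro rfl; exact hz.2.2 hu
      have n6 : z ≠ w := by rintro rfl; exact hz.2.2 hw
      have n7 := Ne.symm hwu
      simp only [List.nodup_cons, List.mem_cons, List.not_mem_nil, or_false, not_or]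
      exact ⟨⟨n1.symm, n5.symm, n3.symm, n7⟩, ⟨Ne.symm hz.1, hxy, n2⟩, ⟨hz.2.1, n6⟩, n4, by simp⟩
    rcases hA with ⟨-, h⟩ | ⟨a1, a2, hA, hua, haw⟩
    · exact huw h
    rcases hB with ⟨-, h⟩ | ⟨b1, b2, hB, hwb, hbu⟩
    · exact huw h.symm
    have l1 := List.length_pos_of_mem hA.mem_left
    have l2 := List.length_pos_of_mem hB.mem_left
    have l3 : A.length = 1 := by omega
    obtain ⟨c, rfl⟩ := List.length_eq_one_iff.1 l3
    have ha1 := hA.mem_left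
    have ha2 := hA.mem_right
    simp only [List.mem_singleton] at ha1 ha2
    subst ha1
    subst ha2
    obtain ⟨e1, e2, e3⟩ := hKL a2 (by simp)
    refine hno (cyc5 hxu.symm axy hyw haw.symm hua.symm ?_)
    have n1 := nx u hu
    have n2 := nx w hw
    have n3 := ny u hu
    have n4 := ny w hw
    have n5 := nx _ e1
    have n6 := ny _ e1
    have n7 := Ne.symm hwu
    simp only [List.nodup_cons, List.mem_cons, List.not_mem_nil, or_false, not_or]
    exact ⟨⟨n1.symm, n3.symm, n7, e2.symm⟩, ⟨hxy, n2, n5⟩, ⟨n4, n6⟩, e3.symm, by simp⟩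
  · have hpq : ∃ p q, p ∈ A ++ B ∧ q ∈ A ++ B ∧ p ≠ q ∧ G.Adj u p ∧ G.Adj q w := by
      rcases hA with ⟨rfl, h⟩ | ⟨a1, a2, hA, hua, haw⟩
      · rcases hB with ⟨rfl, -⟩ | ⟨b1, b2, hB, hwb, hbu⟩
        · simp at hlen; omega
        · refine ⟨b2, b1, by simpa using hB.mem_right, by simpa using hB.mem_left, ?_, hbu.symm,
            hwb.symm⟩
          rintro rfl
          rcases hB.split (by simpa using hAB) with ⟨-, h⟩ | ⟨h, -⟩
          · rw [h] at hlen; simp at hlen; omega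
          · exact h rfl
      · rcases hB with ⟨rfl, -⟩ | ⟨b1, b2, hB, hwb, hbu⟩
        · refine ⟨a1, a2, by simpa using hA.mem_left, by simpa using hA.mem_right, ?_, hua,
            haw⟩
          rintro rfl
          rcases hA.split (by simpa using hAB) with ⟨-, h⟩ | ⟨h, -⟩
          · rw [h] at hlen; simp at hlen; omega
          · exact h rfl
        · refine ⟨a1, b1, List.mem_append_left _ hA.mem_left, List.mem_append_right _ hB.mem_left,
            ?_, hua, hwb.symm⟩
          exact (List.nodup_append.1 hAB).2.2 _ hA.mem_left _ hB.mem_left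
    obtain ⟨p, q, hp, hq, hpq, hup, hqw⟩ := hpq
    obtain ⟨M, m1, m2, m3, m4⟩ := clique_seg hAB clq hp hq hpq (k - 5) (by simp; omega)
    apply hno
    refine HasCyc.mk (M := y :: x :: u :: w :: (p :: (M ++ [q])))
      ((Seg.cons axy.symm (Seg.cons hxu (Seg.cons hup m1))).append (Seg.single w) hqw)
      hyw.symm ?_ ?_ ?_
    · rw [List.perm_iff_count]; intro z
      simp only [List.count_cons, List.count_append, List.count_nil]; ring
    · have g : ∀ c ∈ p :: (M ++ [q]), c ∈ L ∧ c ≠ u ∧ c ≠ w := fun c hc => hKL c (m3 c hc)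
      generalize p :: (M ++ [q]) = N at m2 g
      have n1 := nx u hu
      have n2 := nx w hw
      have n3 := ny u hu
      have n4 := ny w hw
      have g1 : x ∉ N := fun h => hx (g x h).1
      have g2 : y ∉ N := fun h => hy (g y h).1
      have g3 : u ∉ N := fun h => (g u h).2.1 rfl
      have g4 : w ∉ N := fun h => (g w h).2.2 rfl
      simp only [List.nodup_cons, List.mem_cons, not_or]
      exact ⟨⟨hxy.symm, n3, n4, g2⟩, ⟨n1, n2, g1⟩, ⟨Ne.symm hwu, g3⟩, g4, m2⟩
    · simp [m4]; omega

end Helpers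

/-- Every 2-connected [4,2]-graph of order at least 7 is pancyclic. -/
theorem stmt0 {V : Type*} [Fintype V] [DecidableEq V] (G : SimpleGraph V) [DecidableRel G.Adj]
    (h2 : TwoConnected G) (hst : IsSTGraph G 4 2) (hn : 7 ≤ Fintype.card V) :
    Pancyclic G := by
  have H := fourTwo_of hst
  intro k hk hkn
  refine HasCyc.walk hk ?_
  induction k, hk using Nat.le_induction with
  | base => exact exists_tri H hn
  | succ m hm ih =>
    have h := ih (by omega)
    by_cases h3 : m = 3
    · subst h3
      exact cyc4_of_cyc3 H hn h
    · exact step h2 H hn (by omega) (by omega) h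
end

section
/- Every 2-connected [5,3]-graph of order at least 9 with minimum degree at least 3 is pancyclic. -/
/-! ### Paths as lists -/

/-- `PP G a l b`: the sequence `a, l, b` is a walk in `G`. -/
def PP {V : Type*} (G : SimpleGraph V) : V → List V → V → Prop
  | a, [], b => G.Adj a b
  | a, c :: l, b => G.Adj a c ∧ PP G c l b

section
variable {V : Type*} {G : SimpleGraph V}

theorem PP_nil {a b : V} : PP G a [] b ↔ G.Adj a b := Iff.rfl

theorem PP_cons {a b c : V} {l : List V} : PP G a (c :: l) b ↔ G.Adj a c ∧ PP G c l b := Iff.rfl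

theorem PP_app {a b c : V} {l m : List V} :
    PP G a (l ++ c :: m) b ↔ PP G a l c ∧ PP G c m b := by
  induction l generalizing a with
  | nil => simp [PP]
  | cons d l ih => simp [PP, ih, and_assoc]

theorem PP_rev {a b : V} {l : List V} : PP G a l.reverse b ↔ PP G b l a := by
  induction l generalizing b with
  | nil => simp [PP, G.adj_comm]
  | cons d l ih => simp [PP, PP_app, ih, G.adj_comm, and_comm]

/-- the closed sequence `a, t, a` is a cycle of length `t.length + 1`. -/
def IsC (G : SimpleGraph V) (a : V) (t : List V) : Prop :=
  (a :: t).Nodup ∧ 2 ≤ t.length ∧ PP G a t a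

theorem PP_walk {a b : V} {l : List V} (h : PP G a l b) :
    ∃ w : G.Walk a b, w.support = a :: (l ++ [b]) := by
  induction l generalizing a with
  | nil => exact ⟨.cons (PP_nil.1 h) .nil, by simp⟩
  | cons c l ih =>
    obtain ⟨w, hw⟩ := ih h.2
    exact ⟨.cons h.1 w, by simp [hw]⟩

theorem IsC_cycle {a : V} {t : List V} (h : IsC G a t) :
    ∃ (v : V) (c : G.Walk v v), c.IsCycle ∧ c.length = t.length + 1 := by
  obtain ⟨hn, hl, hp⟩ := h
  match t, hl with
  | c :: d :: t, _ =>
    obtain ⟨w, hw⟩ := PP_walk hp.2.2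
    refine ⟨a, .cons hp.1 (.cons hp.2.1 w), ?_, ?_⟩
    · rw [SimpleGraph.Walk.cons_isCycle_iff]
      constructor
      · rw [SimpleGraph.Walk.isPath_def]
        simp only [SimpleGraph.Walk.support_cons, hw]
        simp at hn ⊢
        grind
      · intro hmem
        simp only [SimpleGraph.Walk.edges_cons, List.mem_cons] at hmem
        rcases hmem with h1 | h1
        · simp at h1 hn
          grind
        · have := SimpleGraph.Walk.snd_mem_support_of_mem_edges w h1
          rw [hw] at this
          simp at this hn
          grind
    · have := congrArg List.length hw
      simp at this ⊢
      omega

theorem IsC_rot {a u : V} {t : List V} (h : IsC G a t) (hu : u ∈ a :: t) :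
    ∃ t', IsC G u t' ∧ t'.length = t.length ∧ ∀ x, x ∈ u :: t' ↔ x ∈ a :: t := by
  rcases List.mem_cons.1 hu with rfl | hu
  · exact ⟨t, h, rfl, fun _ => Iff.rfl⟩
  obtain ⟨l, m, rfl⟩ := List.append_of_mem hu
  obtain ⟨hn, hl, hp⟩ := h
  refine ⟨m ++ a :: l, ⟨?_, ?_, ?_⟩, ?_, ?_⟩
  · have : (u :: (m ++ a :: l)).Perm (a :: (l ++ u :: m)) := by
      have : (u :: m ++ a :: l).Perm (a :: l ++ u :: m) := List.perm_append_comm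
      simpa using this
    exact this.nodup_iff.2 hn
  · simp at hl ⊢; omega
  · rw [PP_app] at hp ⊢; exact hp.symm
  · simp; omega
  · intro x; simp; tauto

/-- first hit lemma -/
theorem first_hit {v : V} {S : Set V} (y c : {u : V | u ≠ v})
    (w : (G.induce {u : V | u ≠ v}).Walk y c) (hc : (c : V) ∈ S) (hy : (y : V) ∉ S) :
    ∃ t d, d ∈ S ∧ d ≠ v ∧ PP G (y : V) t d ∧ ((y : V) :: t).Nodup ∧
      (∀ z ∈ t, z ∉ S ∧ z ≠ v) := by
  induction w with
  | nil => exact absurd hc hy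
  | @cons u u' c h w ih =>
    have h' : G.Adj (u : V) (u' : V) := by simpa using h
    by_cases hu : (u' : V) ∈ S
    · exact ⟨[], u', hu, u'.2, h', by simp, by simp⟩
    obtain ⟨t, d, h1, h2, h3, h4, h5⟩ := ih hc hu
    by_cases hm : (u : V) ∈ (u' : V) :: t
    · have hm' : (u : V) ∈ t := by
        rcases List.mem_cons.1 hm with e | e
        · exact absurd e h'.ne
        · exact e
      obtain ⟨l, m, rfl⟩ := List.append_of_mem hm'
      refine ⟨m, d, h1, h2, (PP_app.1 h3).2, ?_, fun z hz => h5 z (by simp [hz])⟩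
      exact (List.nodup_append.1 (List.nodup_cons.1 h4).2).2.1
    · refine ⟨u' :: t, d, h1, h2, ⟨h', h3⟩, List.nodup_cons.2 ⟨hm, h4⟩, ?_⟩
      intro z hz
      rcases List.mem_cons.1 hz with e | e
      · subst e; exact ⟨hu, u'.2⟩
      · exact h5 z e

theorem first_hit' [Fintype V] (h2 : TwoConnected G) {v y c : V} {S : Set V} (hyv : y ≠ v) (hcv : c ≠ v)
    (hc : c ∈ S) (hy : y ∉ S) :
    ∃ t d, d ∈ S ∧ d ≠ v ∧ PP G y t d ∧ (y :: t).Nodup ∧ (∀ z ∈ t, z ∉ S ∧ z ≠ v) := by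
  obtain ⟨w⟩ := (h2.2 v).preconnected ⟨y, hyv⟩ ⟨c, hcv⟩
  exact first_hit _ _ w hc hy

end

section
variable {V : Type*} [DecidableEq V] {G : SimpleGraph V} [DecidableRel G.Adj]

/-- edge indicator -/
def ind {V : Type*} (G : SimpleGraph V) [DecidableRel G.Adj] (a b : V) : ℕ :=
  if G.Adj a b then 1 else 0

theorem five (hst : IsSTGraph G 5 3) {a b c d e : V} (hn : [a, b, c, d, e].Nodup) :
    3 ≤ ind G a b + ind G a c + ind G a d + ind G a e + ind G b c + ind G b d + ind G b e
      + ind G c d + ind G c e + ind G d e := by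
  have h := hst [a, b, c, d, e].toFinset (by rw [List.toFinset_card_of_nodup hn]; rfl)
  let L : List (V × V) := [(a,b),(a,c),(a,d),(a,e),(b,c),(b,d),(b,e),(c,d),(c,e),(d,e)]
  have hsub : ([a, b, c, d, e].toFinset.sym2.filter (· ∈ G.edgeSet)) ⊆
      ((L.filter (fun p => G.Adj p.1 p.2)).map (fun p => s(p.1, p.2))).toFinset := by
    intro p
    induction p with
    | _ u v =>
      simp only [Finset.mem_filter, Finset.mk_mem_sym2_iff, List.mem_toFinset,
        SimpleGraph.mem_edgeSet, List.mem_map, List.mem_filter]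
      rintro ⟨⟨hu, hv⟩, hadj⟩
      have key : (u, v) ∈ L ∨ (v, u) ∈ L := by
        have hne := hadj.ne
        simp only [List.mem_cons, List.not_mem_nil, or_false] at hu hv
        simp only [L, List.mem_cons, List.not_mem_nil, or_false, Prod.mk.injEq]
        rcases hu with rfl | rfl | rfl | rfl | rfl <;> rcases hv with rfl | rfl | rfl | rfl | rfl <;>
          simp_all
      rcases key with k | k
      · exact ⟨(u, v), ⟨k, by simpa using hadj⟩, rfl⟩
      · exact ⟨(v, u), ⟨k, by simpa using hadj.symm⟩, Sym2.eq_swap⟩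
  have h1 := h.trans (Finset.card_le_card hsub)
  have h2 := h1.trans (List.toFinset_card_le _)
  rw [List.length_map] at h2
  refine h2.trans (le_of_eq ?_)
  rw [← List.countP_eq_length_filter]
  simp only [L, List.countP_cons, List.countP_nil, ind, decide_eq_true_eq]
  ring
end

/-! ### Hamiltonicity -/

set_option linter.unusedSimpArgs false
set_option linter.unusedSectionVars false

section
variable {V : Type*} [DecidableEq V] {G : SimpleGraph V} [DecidableRel G.Adj]

theorem nodup_of_count {l m : List V} (h : m.Nodup) (hc : ∀ x, l.count x ≤ m.count x) :
    l.Nodup := by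
  rw [List.nodup_iff_count_le_one] at *
  exact fun x => (hc x).trans (h x)

/-- an ear with at least two inner vertices contradicts maximality -/
theorem ear_long (hst : IsSTGraph G 5 3) {k : ℕ} (hmax : ∀ a t, IsC G a t → t.length + 1 ≤ k)
    {a b h i : V} {P Q H : List V} (hP : PP G a P b) (hQ : PP G b Q a)
    (hk : P.length + Q.length + 2 = k)
    (hH : PP G a (h :: i :: H) b) (hn : (a :: (P ++ b :: Q ++ h :: i :: H)).Nodup) : False := by
  have app : ∀ u t, (∀ x, (u :: t).count x ≤ (a :: (P ++ b :: Q ++ h :: i :: H)).count x) →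
      PP G u t u → k ≤ t.length → 2 ≤ t.length → False := by
    intro u t h1 h2 h3 h4
    have := hmax u t ⟨nodup_of_count hn h1, h4, h2⟩
    omega
  match P, Q with
  | [], Q =>
    refine app a (h :: i :: H ++ b :: Q) ?_ (PP_app.2 ⟨hH, hQ⟩) ?_ ?_
    · intro x
      simp only [List.count_append, List.count_cons, List.count_nil]; omega
    · simp at hk ⊢; omega
    · simp
  | [p], Q =>
    refine app a (h :: i :: H ++ b :: Q) ?_ (PP_app.2 ⟨hH, hQ⟩) ?_ ?_
    · intro x
      simp only [List.count_append, List.count_cons, List.count_nil]; omega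
    · simp at hk ⊢; omega
    · simp
  | p :: z :: P, [] =>
    refine app b ((h :: i :: H).reverse ++ a :: (p :: z :: P)) ?_ (PP_app.2 ⟨PP_rev.2 hH, hP⟩) ?_ ?_
    · intro x
      simp only [List.count_append, List.count_cons, List.count_nil, List.count_reverse]; omega
    · simp at hk ⊢; omega
    · simp; omega
  | p :: z :: P, q :: Q =>
    simp only [PP_cons] at hP hQ hH
    obtain ⟨hap, hpz, hP⟩ := hP
    obtain ⟨hbq, hQ⟩ := hQ
    obtain ⟨hah, hhi, hH⟩ := hH
    have e1 : ¬ G.Adj h p := by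
      intro e
      refine app a (h :: p :: z :: P ++ b :: q :: Q) ?_ ?_ ?_ ?_
      · intro x
        simp only [List.count_append, List.count_cons, List.count_nil, List.count_reverse]; omega
      · simp [PP_app, PP_cons, PP_rev, PP_nil, *]
      · simp at hk ⊢; omega
      · simp
    have e2 : ¬ G.Adj i p := by
      intro e
      refine app a (h :: i :: p :: z :: P ++ b :: q :: Q) ?_ ?_ ?_ ?_
      · intro x
        simp only [List.count_append, List.count_cons, List.count_nil, List.count_reverse]; omega
      · simp [PP_app, PP_cons, PP_rev, PP_nil, *]
      · simp at hk ⊢; omega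
      · simp
    have e3 : ¬ G.Adj h q := by
      intro e
      refine app b (H.reverse ++ i :: h :: q :: Q ++ a :: p :: z :: P) ?_ ?_ ?_ ?_
      · intro x
        simp only [List.count_append, List.count_cons, List.count_nil, List.count_reverse]; omega
      · simp [PP_app, PP_cons, PP_rev, PP_nil, hhi.symm, *]
      · simp at hk ⊢; omega
      · simp; omega
    have e4 : ¬ G.Adj i q := by
      intro e
      refine app b (H.reverse ++ i :: q :: Q ++ a :: p :: z :: P) ?_ ?_ ?_ ?_
      · intro x
        simp only [List.count_append, List.count_cons, List.count_nil, List.count_reverse]; omega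
      · simp [PP_app, PP_cons, PP_rev, PP_nil, hhi.symm, *]
      · simp at hk ⊢; omega
      · simp; omega
    have e5 : ¬ G.Adj p q := by
      intro e
      refine app a (h :: i :: H ++ b :: (P.reverse ++ z :: p :: q :: Q)) ?_ ?_ ?_ ?_
      · intro x
        simp only [List.count_append, List.count_cons, List.count_nil, List.count_reverse]; omega
      · simp [PP_app, PP_cons, PP_rev, PP_nil, hpz.symm, *]
      · simp at hk ⊢; omega
      · simp
    have e6 : ¬ G.Adj z i := by
      intro e
      refine app a (h :: i :: z :: P ++ b :: q :: Q) ?_ ?_ ?_ ?_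
      · intro x
        simp only [List.count_append, List.count_cons, List.count_nil, List.count_reverse]; omega
      · simp [PP_app, PP_cons, PP_rev, PP_nil, e.symm, *]
      · simp at hk ⊢; omega
      · simp
    have e7 : ¬ G.Adj z q := by
      intro e
      refine app a (h :: i :: H ++ b :: (P.reverse ++ z :: q :: Q)) ?_ ?_ ?_ ?_
      · intro x
        simp only [List.count_append, List.count_cons, List.count_nil, List.count_reverse]; omega
      · simp [PP_app, PP_cons, PP_rev, PP_nil, *]
      · simp at hk ⊢; omega
      · simp
    have hzh : G.Adj z h := by
      by_contra e8
      have := five hst (a := z) (b := h) (c := i) (d := p) (e := q) (nodup_of_count hn (by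
        intro x
        simp only [List.count_append, List.count_cons, List.count_nil, List.count_reverse]; omega))
      simp [ind, *] at this
      split_ifs at this <;> omega
    match P with
    | [] =>
      refine app a (p :: z :: h :: i :: H ++ b :: q :: Q) ?_ ?_ ?_ ?_
      · intro x
        simp only [List.count_append, List.count_cons, List.count_nil, List.count_reverse]; omega
      · simp [PP_app, PP_cons, PP_rev, PP_nil, *]
      · simp at hk ⊢; omega
      · simp
    | w :: P =>
      simp only [PP_cons] at hP
      obtain ⟨hzw, hP⟩ := hP
      have f1 : ¬ G.Adj h w := by
        intro e
        refine app a (p :: z :: h :: w :: P ++ b :: q :: Q) ?_ ?_ ?_ ?_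
        · intro x
          simp only [List.count_append, List.count_cons, List.count_nil, List.count_reverse]; omega
        · simp [PP_app, PP_cons, PP_rev, PP_nil, *]
        · simp at hk ⊢; omega
        · simp
      have f2 : ¬ G.Adj i w := by
        intro e
        refine app a (p :: z :: h :: i :: w :: P ++ b :: q :: Q) ?_ ?_ ?_ ?_
        · intro x
          simp only [List.count_append, List.count_cons, List.count_nil, List.count_reverse]; omega
        · simp [PP_app, PP_cons, PP_rev, PP_nil, *]
        · simp at hk ⊢; omega
        · simp
      have f3 : ¬ G.Adj p w := by
        intro e
        refine app a (h :: z :: p :: w :: P ++ b :: q :: Q) ?_ ?_ ?_ ?_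
        · intro x
          simp only [List.count_append, List.count_cons, List.count_nil, List.count_reverse]; omega
        · simp [PP_app, PP_cons, PP_rev, PP_nil, hpz.symm, hzh.symm, *]
        · simp at hk ⊢; omega
        · simp
      have f4 : ¬ G.Adj q w := by
        intro e
        refine app z (h :: i :: H ++ b :: (P.reverse ++ w :: q :: Q) ++ [a, p]) ?_ ?_ ?_ ?_
        · intro x
          simp only [List.count_append, List.count_cons, List.count_nil, List.count_reverse]; omega
        · simp [PP_app, PP_cons, PP_rev, PP_nil, e.symm, *]
        · simp at hk ⊢; omega
        · simp
      have := five hst (a := h) (b := i) (c := p) (d := q) (e := w) (nodup_of_count hn (by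
        intro x
        simp only [List.count_append, List.count_cons, List.count_nil, List.count_reverse]; omega))
      simp [ind, *] at this

/-- crossing lemma for two neighbours of an outside vertex -/
theorem cross {k : ℕ} (hmax : ∀ a t, IsC G a t → t.length + 1 ≤ k)
    {a b x p q : V} {P Q : List V} (hC : PP G a (p :: P ++ b :: q :: Q) a)
    (hk : P.length + Q.length + 4 = k) (hxa : G.Adj x a) (hxb : G.Adj x b)
    (hn : (x :: a :: (p :: P ++ b :: q :: Q)).Nodup) : ¬ G.Adj p q ∧ ¬ G.Adj x p := by
  simp only [PP_app, PP_cons] at hC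
  constructor
  · intro e
    have := hmax a (x :: b :: (P.reverse ++ p :: q :: Q)) ⟨nodup_of_count hn (by
        intro x
        simp only [List.count_append, List.count_cons, List.count_nil, List.count_reverse]; omega),
        by simp, by simp [PP_app, PP_cons, PP_rev, hxa.symm, *]⟩
    simp at this; omega
  · intro e
    have := hmax a (x :: p :: P ++ b :: q :: Q) ⟨nodup_of_count hn (by
        intro x
        simp only [List.count_append, List.count_cons, List.count_nil, List.count_reverse]; omega),
        by simp, by simp [PP_app, PP_cons, PP_rev, hxa.symm, *]⟩
    simp at this; omega

theorem noconsec {k : ℕ} (hmax : ∀ a t, IsC G a t → t.length + 1 ≤ k)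
    {a b x : V} {Q : List V} (hC : PP G a (b :: Q) a)
    (hk : Q.length + 2 = k) (hxa : G.Adj x a) (hxb : G.Adj x b)
    (hn : (x :: a :: b :: Q).Nodup) : False := by
  simp only [PP_cons] at hC
  have := hmax a (x :: b :: Q) ⟨nodup_of_count hn (by
        intro x
        simp only [List.count_cons]; omega),
        by simp, by simp [PP_cons, hxa.symm, *]⟩
  simp at this; omega

/-- an outside vertex cannot have four neighbours on a longest cycle -/
theorem four_nbr (hst : IsSTGraph G 5 3) {k : ℕ} (hmax : ∀ a t, IsC G a t → t.length + 1 ≤ k)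
    {a b c d x : V} {P Q R S : List V} (hP : PP G a P b) (hQ : PP G b Q c) (hR : PP G c R d)
    (hS : PP G d S a) (hk : P.length + Q.length + R.length + S.length + 4 = k)
    (hxa : G.Adj x a) (hxb : G.Adj x b) (hxc : G.Adj x c) (hxd : G.Adj x d)
    (hn : (x :: a :: (P ++ b :: (Q ++ c :: (R ++ d :: S)))).Nodup) : False := by
  match P, Q, R, S with
  | [], Q, R, S =>
    refine noconsec hmax (a := a) (b := b) (x := x) (Q := Q ++ c :: (R ++ d :: S)) ?_ ?_ hxa hxb ?_
    · simp [PP_app, PP_cons, PP_nil] at *; simp [*]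
    · simp at hk ⊢; omega
    · simpa using hn
  | P, [], R, S =>
    refine noconsec hmax (a := b) (b := c) (x := x) (Q := R ++ d :: (S ++ a :: P)) ?_ ?_ hxb hxc ?_
    · simp [PP_app, PP_cons, PP_nil] at *; simp [*]
    · simp at hk ⊢; omega
    · refine nodup_of_count hn ?_
      intro x; simp only [List.count_append, List.count_cons, List.count_nil]; omega
  | P, Q, [], S =>
    refine noconsec hmax (a := c) (b := d) (x := x) (Q := S ++ a :: (P ++ b :: Q)) ?_ ?_ hxc hxd ?_
    · simp [PP_app, PP_cons, PP_nil] at *; simp [*]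
    · simp at hk ⊢; omega
    · refine nodup_of_count hn ?_
      intro x; simp only [List.count_append, List.count_cons, List.count_nil]; omega
  | P, Q, R, [] =>
    refine noconsec hmax (a := d) (b := a) (x := x) (Q := P ++ b :: (Q ++ c :: R)) ?_ ?_ hxd hxa ?_
    · simp [PP_app, PP_cons, PP_nil] at *; simp [*]
    · simp at hk ⊢; omega
    · refine nodup_of_count hn ?_
      intro x; simp only [List.count_append, List.count_cons, List.count_nil]; omega
  | p :: P, q :: Q, r :: R, s :: S =>
    simp only [PP_cons] at hP hQ hR hS
    have cr := @cross V _ G _ k hmax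
    have c1 := @cr a b x p q P (Q ++ c :: r :: (R ++ d :: s :: S))
      (by simp [PP_app, PP_cons, hP, hQ, hR, hS]) (by simp at hk ⊢; omega) hxa hxb
      (by simpa using hn)
    have c2 := @cr b c x q r Q (R ++ d :: s :: (S ++ a :: p :: P))
      (by simp [PP_app, PP_cons, hP, hQ, hR, hS]) (by simp at hk ⊢; omega) hxb hxc
      (nodup_of_count hn (by
        intro x; simp only [List.count_append, List.count_cons, List.count_nil]; omega))
    have c3 := @cr c d x r s R (S ++ a :: p :: (P ++ b :: q :: Q))
      (by simp [PP_app, PP_cons, hP, hQ, hR, hS]) (by simp at hk ⊢; omega) hxc hxd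
      (nodup_of_count hn (by
        intro x; simp only [List.count_append, List.count_cons, List.count_nil]; omega))
    have c4 := @cr d a x s p S (P ++ b :: q :: (Q ++ c :: r :: R))
      (by simp [PP_app, PP_cons, hP, hQ, hR, hS]) (by simp at hk ⊢; omega) hxd hxa
      (nodup_of_count hn (by
        intro x; simp only [List.count_append, List.count_cons, List.count_nil]; omega))
    have c5 := @cr a c x p r (P ++ b :: q :: Q) (R ++ d :: s :: S)
      (by simp [PP_app, PP_cons, hP, hQ, hR, hS]) (by simp at hk ⊢; omega) hxa hxc
      (nodup_of_count hn (by
        intro x; simp only [List.count_append, List.count_cons, List.count_nil]; omega))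
    have c6 := @cr b d x q s (Q ++ c :: r :: R) (S ++ a :: p :: P)
      (by simp [PP_app, PP_cons, hP, hQ, hR, hS]) (by simp at hk ⊢; omega) hxb hxd
      (nodup_of_count hn (by
        intro x; simp only [List.count_append, List.count_cons, List.count_nil]; omega))
    have := five hst (a := x) (b := p) (c := q) (d := r) (e := s) (nodup_of_count hn (by
        intro x
        simp only [List.count_append, List.count_cons, List.count_nil]; omega))
    have c4' : ¬ G.Adj p s := fun h => c4.1 (G.adj_symm h)
    clear cr hmax
    simp [ind, c1, c2, c3, c4, c4', c5, c6] at this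

/-- consequences of three neighbours on a longest cycle -/
theorem three_nbr (hst : IsSTGraph G 5 3) {k : ℕ} (hmax : ∀ a t, IsC G a t → t.length + 1 ≤ k)
    {a b c x p q r : V} {P Q R : List V}
    (hP : PP G a (p :: P) b) (hQ : PP G b (q :: Q) c) (hR : PP G c (r :: R) a)
    (hk : P.length + Q.length + R.length + 6 = k)
    (hxa : G.Adj x a) (hxb : G.Adj x b) (hxc : G.Adj x c)
    (hn : (x :: a :: (p :: P ++ b :: (q :: Q ++ c :: r :: R))).Nodup)
    (hx : ∀ z, G.Adj x z → z = a ∨ z = b ∨ z = c) :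
    ¬ G.Adj p q ∧ ¬ G.Adj q r ∧ ¬ G.Adj r p ∧
    ∀ z, z ∉ [x, a, b, c, p, q, r] → G.Adj z p ∧ G.Adj z q ∧ G.Adj z r := by
  simp only [PP_cons] at hP hQ hR
  have cr := @cross V _ G _ k hmax
  have c1 := @cr a b x p q P (Q ++ c :: r :: R)
    (by simp [PP_app, PP_cons, hP, hQ, hR]) (by simp at hk ⊢; omega) hxa hxb
    (by simpa using hn)
  have c2 := @cr b c x q r Q (R ++ a :: p :: P)
    (by simp [PP_app, PP_cons, hP, hQ, hR]) (by simp at hk ⊢; omega) hxb hxc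
    (nodup_of_count hn (by
      intro x; simp only [List.count_append, List.count_cons, List.count_nil]; omega))
  have c3 := @cr c a x r p R (P ++ b :: q :: Q)
    (by simp [PP_app, PP_cons, hP, hQ, hR]) (by simp at hk ⊢; omega) hxc hxa
    (nodup_of_count hn (by
      intro x; simp only [List.count_append, List.count_cons, List.count_nil]; omega))
  refine ⟨c1.1, c2.1, c3.1, fun z hz => ?_⟩
  have hnd : [z, x, p, q, r].Nodup := by
    have : [x, p, q, r].Nodup := nodup_of_count hn (by
      intro x; simp only [List.count_append, List.count_cons, List.count_nil]; omega)
    simp only [List.mem_cons] at hz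
    simp only [List.nodup_cons, List.mem_cons] at this ⊢
    tauto
  have hzx : ¬ G.Adj z x := by
    intro e
    have := hx z e.symm
    simp only [List.mem_cons] at hz
    tauto
  have := five hst hnd
  have c3' := fun h => c3.1 (G.adj_symm h)
  simp only [ind, c1, c2, c3, c3', hzx, if_false] at this
  split_ifs at this <;> first | omega | exact ⟨‹_›, ‹_›, ‹_›⟩

end

section
variable {V : Type*} [DecidableEq V] {G : SimpleGraph V} [DecidableRel G.Adj]

/-- the segments have at most two vertices -/
theorem seg_short (hst : IsSTGraph G 5 3) {k : ℕ} (hmax : ∀ a t, IsC G a t → t.length + 1 ≤ k)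
    {a b c x p q r w w' : V} {P Q R : List V}
    (hP : PP G a (p :: w :: w' :: P) b) (hQ : PP G b (q :: Q) c) (hR : PP G c (r :: R) a)
    (hk : P.length + Q.length + R.length + 8 = k)
    (hxa : G.Adj x a) (hxb : G.Adj x b) (hxc : G.Adj x c)
    (hn : (x :: a :: (p :: w :: w' :: P ++ b :: (q :: Q ++ c :: r :: R))).Nodup)
    (hx : ∀ z, G.Adj x z → z = a ∨ z = b ∨ z = c) : False := by
  obtain ⟨-, -, -, h⟩ := three_nbr hst hmax hP hQ hR (by simp; omega) hxa hxb hxc hn hx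
  have hw := h w (by
    have : (w :: [x, a, b, c, p, q, r]).Nodup := nodup_of_count hn (by
      intro x; simp only [List.count_append, List.count_cons, List.count_nil]; omega)
    exact (List.nodup_cons.1 this).1)
  have hw' := h w' (by
    have : (w' :: [x, a, b, c, p, q, r]).Nodup := nodup_of_count hn (by
      intro x; simp only [List.count_append, List.count_cons, List.count_nil]; omega)
    exact (List.nodup_cons.1 this).1)
  simp only [PP_cons] at hP hQ hR
  have := hmax a (x :: b :: (P.reverse ++ w' :: p :: w :: q :: Q ++ c :: r :: R))
    ⟨nodup_of_count hn (by
      intro x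
      simp only [List.count_append, List.count_cons, List.count_nil, List.count_reverse]; omega),
      by simp, by simp [PP_app, PP_cons, PP_rev, hxa.symm, hxb, hP, hQ, hR, hw, hw']⟩
  simp at this; omega

theorem mixed (hst : IsSTGraph G 5 3) {k : ℕ} (hmax : ∀ a t, IsC G a t → t.length + 1 ≤ k)
    {a b c x p q r p' : V} {Q : List V}
    (hP : PP G a [p, p'] b) (hQ : PP G b (q :: Q) c) (hR : PP G c [r] a)
    (hk : Q.length + 7 = k)
    (hxa : G.Adj x a) (hxb : G.Adj x b) (hxc : G.Adj x c)
    (hn : (x :: a :: ([p, p'] ++ b :: (q :: Q ++ [c, r]))).Nodup)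
    (hx : ∀ z, G.Adj x z → z = a ∨ z = b ∨ z = c) : False := by
  obtain ⟨-, -, -, h⟩ := three_nbr hst hmax hP hQ hR (by simp; omega) hxa hxb hxc hn hx
  have hw := h p' (by
    have : (p' :: [x, a, b, c, p, q, r]).Nodup := nodup_of_count hn (by
      intro x; simp only [List.count_append, List.count_cons, List.count_nil]; omega)
    exact (List.nodup_cons.1 this).1)
  have hQr := PP_rev.2 hQ
  have hc : ∀ x, (q :: Q).reverse.count x = (q :: Q).count x := fun x => List.count_reverse
  have hl : (q :: Q).reverse.length = Q.length + 1 := by simp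
  match hrev : (q :: Q).reverse with
  | [] => simp at hrev
  | s :: S =>
    rw [hrev] at hQr hc hl
    have := three_nbr hst hmax (PP_rev.2 hR) hQr (PP_rev.2 hP) (by simp at hl ⊢; omega) hxa hxc hxb
      (nodup_of_count hn (by
        intro x
        have := hc x
        simp only [List.count_append, List.count_cons, List.count_nil] at this ⊢; omega))
      (fun z hz => by have := hx z hz; tauto)
    exact this.2.2.1 hw.2.2

theorem three_false [Fintype V] (hcard : 9 ≤ Fintype.card V)
    (hst : IsSTGraph G 5 3) {k : ℕ} (hmax : ∀ a t, IsC G a t → t.length + 1 ≤ k)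
    {a b c x : V} {P Q R : List V}
    (hP : PP G a P b) (hQ : PP G b Q c) (hR : PP G c R a)
    (hk : P.length + Q.length + R.length + 3 = k)
    (hxa : G.Adj x a) (hxb : G.Adj x b) (hxc : G.Adj x c)
    (hn : (x :: a :: (P ++ b :: (Q ++ c :: R))).Nodup)
    (hx : ∀ z, G.Adj x z → z = a ∨ z = b ∨ z = c) : False := by
  have hPrev := PP_rev.2 hP
  have hQrev := PP_rev.2 hQ
  have hRrev := PP_rev.2 hR
  have hx1 : ∀ z, G.Adj x z → z = b ∨ z = c ∨ z = a := fun z h => by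
    have := hx z h; tauto
  have hx2 : ∀ z, G.Adj x z → z = c ∨ z = a ∨ z = b := fun z h => by
    have := hx z h; tauto
  have hx3 : ∀ z, G.Adj x z → z = a ∨ z = c ∨ z = b := fun z h => by
    have := hx z h; tauto
  match P, Q, R with
  | [], Q, R =>
    refine noconsec hmax (a := a) (b := b) (x := x) (Q := Q ++ c :: R) ?_ ?_ hxa hxb ?_
    · simp only [PP_app, PP_cons, PP_nil] at *; simp [*]
    · simp at hk ⊢; omega
    · simpa using hn
  | P, [], R =>
    refine noconsec hmax (a := b) (b := c) (x := x) (Q := R ++ a :: P) ?_ ?_ hxb hxc ?_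
    · simp only [PP_app, PP_cons, PP_nil] at *; simp [*]
    · simp at hk ⊢; omega
    · refine nodup_of_count hn ?_
      intro x; simp only [List.count_append, List.count_cons, List.count_nil]; omega
  | P, Q, [] =>
    refine noconsec hmax (a := c) (b := a) (x := x) (Q := P ++ b :: Q) ?_ ?_ hxc hxa ?_
    · simp only [PP_app, PP_cons, PP_nil] at *; simp [*]
    · simp at hk ⊢; omega
    · refine nodup_of_count hn ?_
      intro x; simp only [List.count_append, List.count_cons, List.count_nil]; omega
  | p :: p' :: p'' :: P, q :: Q, r :: R =>
    exact seg_short hst hmax hP hQ hR (by simp at hk; omega) hxa hxb hxc hn hx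
  | p :: P, q :: q' :: q'' :: Q, r :: R =>
    exact seg_short hst hmax hQ hR hP (by simp at hk; omega) hxb hxc hxa (nodup_of_count hn (by
      intro x; simp only [List.count_append, List.count_cons, List.count_nil]; omega)) hx1
  | p :: P, q :: Q, r :: r' :: r'' :: R =>
    exact seg_short hst hmax hR hP hQ (by simp at hk; omega) hxc hxa hxb (nodup_of_count hn (by
      intro x; simp only [List.count_append, List.count_cons, List.count_nil]; omega)) hx2
  | [p], [q], [r] =>
    obtain ⟨-, -, -, h⟩ := three_nbr hst hmax hP hQ hR (by simp at hk ⊢; omega) hxa hxb hxc hn hx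
    have hex : ∀ S : List V, S.length ≤ 8 → ∃ y, y ∉ S := by
      intro S hS
      by_contra hcon
      push Not at hcon
      have h1 : (Finset.univ : Finset V) ⊆ S.toFinset := fun z _ => by simpa using hcon z
      have := (Finset.card_le_card h1).trans (List.toFinset_card_le S)
      rw [Finset.card_univ] at this
      omega
    obtain ⟨y, hy⟩ := hex [x, a, b, c, p, q, r] (by simp)
    obtain ⟨z, hz⟩ := hex [y, x, a, b, c, p, q, r] (by simp)
    have hy' := h y hy
    have hz' := h z (fun hh => hz (List.mem_cons_of_mem _ hh))
    have hn2 : (z :: y :: [x, a, b, c, p, q, r]).Nodup := by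
      refine List.nodup_cons.2 ⟨hz, List.nodup_cons.2 ⟨hy, nodup_of_count hn ?_⟩⟩
      intro x; simp only [List.count_append, List.count_cons, List.count_nil]; omega
    simp only [PP_cons, PP_nil] at hP hQ hR
    have := hmax p [y, q, z, r, a, x, b] ⟨nodup_of_count hn2 (by
      intro x; simp only [List.count_append, List.count_cons, List.count_nil]; omega), by simp, by
      simp [PP_cons, PP_nil, hP, hQ, hR, hy', hz', hxa, hxb, hxa.symm, hxb.symm, hy'.1.symm,
        hy'.2.1.symm, hz'.2.1.symm, hP.2.symm]⟩
    simp at this hk; omega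
  | [p, p'], [q, q'], [r, r'] =>
    obtain ⟨-, -, -, h⟩ := three_nbr hst hmax hP hQ hR (by simp at hk ⊢; omega) hxa hxb hxc hn hx
    have g : ∀ w, (w :: [x, a, b, c, p, q, r]).Nodup → G.Adj w p ∧ G.Adj w q ∧ G.Adj w r :=
      fun w hw => h w (List.nodup_cons.1 hw).1
    have gp := g p' (nodup_of_count hn (by
      intro x; simp only [List.count_append, List.count_cons, List.count_nil]; omega))
    have gr := g r' (nodup_of_count hn (by
      intro x; simp only [List.count_append, List.count_cons, List.count_nil]; omega))
    simp only [PP_cons, PP_nil] at hP hQ hR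
    have := hmax x [a, r', p, p', r, c, q', q, b] ⟨nodup_of_count hn (by
      intro x; simp only [List.count_append, List.count_cons, List.count_nil]; omega), by simp, by
      simp [PP_cons, PP_nil, hP, hQ, hR, gp, gr, hxa, hxb.symm, hR.2.2.symm, hR.1.symm,
        hQ.2.2.symm, hQ.2.1.symm, hQ.1.symm]⟩
    simp at this hk; omega
  | [p, p'], q :: Q, [r] =>
    exact mixed hst hmax hP hQ hR (by simp at hk; omega) hxa hxb hxc hn hx
  | [p], [q, q'], r :: R =>
    exact mixed hst hmax hQ hR hP (by simp at hk; omega) hxb hxc hxa (nodup_of_count hn (by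
      intro x; simp only [List.count_append, List.count_cons, List.count_nil]; omega)) hx1
  | p :: P, [q], [r, r'] =>
    exact mixed hst hmax hR hP hQ (by simp at hk; omega) hxc hxa hxb (nodup_of_count hn (by
      intro x; simp only [List.count_append, List.count_cons, List.count_nil]; omega)) hx2

/-- existence of a Hamilton cycle -/
theorem ham [Fintype V] (h2 : TwoConnected G) (hst : IsSTGraph G 5 3) (hcard : 9 ≤ Fintype.card V)
    (hδ : ∀ v : V, 3 ≤ G.degree v) : ∃ a t, IsC G a t ∧ t.length + 1 = Fintype.card V := by
  have hbound : ∀ a t, IsC G a t → t.length + 1 ≤ Fintype.card V := by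
    intro a t h
    have := h.1.length_le_card
    simpa using this
  -- some cycle
  have hex : ∃ a t, IsC G a t := by
    obtain ⟨v⟩ : Nonempty V := Fintype.card_pos_iff.1 (by omega)
    have hd : 1 < (G.neighborFinset v).card := by
      have := hδ v
      rw [← G.card_neighborFinset_eq_degree] at this
      omega
    obtain ⟨y, hy, c, hc, hyc⟩ := Finset.one_lt_card.1 hd
    rw [SimpleGraph.mem_neighborFinset] at hy hc
    obtain ⟨t, d, h3, h4, h5, h6, h7⟩ := first_hit' h2 (v := v) (y := y) (c := c) (S := {c})
      hy.ne' hc.ne' rfl hyc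
    have h3 : d = c := h3
    subst h3
    refine ⟨v, y :: t ++ [d], ?_, by simp, ?_⟩
    · have a1 : v ∉ t := fun h => (h7 v h).2 rfl
      have a2 : d ∉ t := fun h => (h7 d h).1 rfl
      simp only [List.cons_append, List.nodup_cons, List.mem_cons, List.mem_append,
        List.nodup_append] at h6 ⊢
      have := hy.ne
      have := hc.ne
      simp
      grind
    · rw [PP_app]
      exact ⟨⟨hy, h5⟩, hc.symm⟩
  -- longest cycle
  obtain ⟨a, t, hC, hmax⟩ : ∃ a t, IsC G a t ∧ ∀ a' t', IsC G a' t' → t'.length + 1 ≤ t.length + 1 := by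
    classical
    obtain ⟨a0, t0, h0⟩ := hex
    have hs := Nat.findGreatest_spec (P := fun m => ∃ a t, IsC G a t ∧ t.length + 1 = m)
      (hbound a0 t0 h0) ⟨a0, t0, h0, rfl⟩
    obtain ⟨a, t, h1, h3⟩ := hs
    refine ⟨a, t, h1, fun a' t' h' => ?_⟩
    rw [h3]
    exact Nat.le_findGreatest (hbound a' t' h') ⟨a', t', h', rfl⟩
  refine ⟨a, t, hC, le_antisymm (hbound a t hC) ?_⟩
  by_contra hlt
  push Not at hlt
  -- an outside vertex
  obtain ⟨x0, hx0⟩ : ∃ x, x ∉ a :: t := by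
    by_contra hcon
    push Not at hcon
    have h1 : (Finset.univ : Finset V) ⊆ (a :: t).toFinset := fun z _ => by
      rw [List.mem_toFinset]; exact hcon z
    have := (Finset.card_le_card h1).trans (List.toFinset_card_le _)
    rw [Finset.card_univ] at this
    simp at this
    omega
  have two : ∀ v, ∃ c ∈ a :: t, c ≠ v := by
    intro v
    obtain ⟨hn, hl, -⟩ := hC
    match t, hl with
    | b :: t, _ =>
      by_cases h : a = v
      · refine ⟨b, by simp, ?_⟩
        rintro rfl
        simp [h] at hn
      · exact ⟨a, by simp, h⟩
  -- every ear has one inner vertex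
  have ear : ∀ c d h i H, c ∈ a :: t → d ∈ a :: t → c ≠ d → PP G c (h :: i :: H) d →
      (h :: i :: H).Nodup → (∀ z ∈ h :: i :: H, z ∉ a :: t) → False := by
    intro c d h i H hc hd hcd hp hn hout
    obtain ⟨t', hC', hl', hm'⟩ := IsC_rot hC hc
    have hd' : d ∈ t' := by
      have := (hm' d).2 hd
      rcases List.mem_cons.1 this with e | e
      · exact absurd e.symm hcd
      · exact e
    obtain ⟨P, Q, rfl⟩ := List.append_of_mem hd'
    obtain ⟨q1, q2, q3⟩ := hC'
    rw [PP_app] at q3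
    refine ear_long hst hmax q3.1 q3.2 (by simp at hl' ⊢; omega) hp ?_
    have : ((c :: (P ++ d :: Q)) ++ (h :: i :: H)).Nodup := by
      rw [List.nodup_append]
      refine ⟨q1, hn, ?_⟩
      rintro u hu v hv rfl
      exact hout u hv ((hm' u).1 hu)
    simpa using this
  -- outside vertex with a neighbour on the cycle
  obtain ⟨x, c, hx, hc, hxc⟩ : ∃ x c, x ∉ a :: t ∧ c ∈ a :: t ∧ G.Adj x c := by
    obtain ⟨v, hv, -⟩ := two x0
    obtain ⟨c, hc, hcv⟩ := two v
    obtain ⟨t', d, h3, h4, h5, h6, h7⟩ := first_hit' h2 (v := v) (y := x0) (c := c)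
      (S := {z | z ∈ a :: t}) (fun e => hx0 (e ▸ hv)) hcv hc hx0
    rcases List.eq_nil_or_concat t' with rfl | ⟨l, w, rfl⟩
    · exact ⟨x0, d, hx0, h3, h5⟩
    · rw [List.concat_eq_append, PP_app] at h5
      exact ⟨w, d, (h7 w (by simp)).1, h3, h5.2⟩
  obtain ⟨d, hd, hdc, hxd⟩ : ∃ d ∈ a :: t, d ≠ c ∧ G.Adj x d := by
    obtain ⟨e, he, hec⟩ := two c
    obtain ⟨t', d, h3, h4, h5, h6, h7⟩ := first_hit' h2 (v := c) (y := x) (c := e)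
      (S := {z | z ∈ a :: t}) (fun e => hx (e ▸ hc)) hec he hx
    match t' with
    | [] => exact ⟨d, h3, h4, h5⟩
    | i :: t' =>
      exfalso
      refine ear c d x i t' hc h3 h4.symm ⟨hxc.symm, h5⟩ h6 ?_
      intro z hz
      rcases List.mem_cons.1 hz with e | e
      · exact e ▸ hx
      · exact (h7 z e).1
  have hin : ∀ y, G.Adj x y → y ∈ a :: t := by
    intro y hxy
    by_contra hy
    obtain ⟨t', e, h3, h4, h5, h6, h7⟩ := first_hit' h2 (v := x) (y := y) (c := c)
      (S := {z | z ∈ a :: t}) hxy.ne' hxc.ne' hc hy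
    have key : ∀ f, f ∈ a :: t → G.Adj x f → f ≠ e → False := by
      intro f hf hxf hfe
      refine ear f e x y t' hf h3 hfe ⟨hxf.symm, hxy, h5⟩ ?_ ?_
      · refine List.nodup_cons.2 ⟨?_, h6⟩
        intro hm
        rcases List.mem_cons.1 hm with e | e
        · exact hxy.ne e
        · exact (h7 x e).2 rfl
      · intro z hz
        rcases List.mem_cons.1 hz with e | hz
        · exact e ▸ hx
        rcases List.mem_cons.1 hz with e | e
        · exact e ▸ hy
        · exact (h7 z e).1
    by_cases hce : c = e
    · exact key d hd hxd (hce ▸ hdc)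
    · exact key c hc hxc hce
  -- third neighbour
  obtain ⟨e, hxe, hec, hed⟩ : ∃ e, G.Adj x e ∧ e ≠ c ∧ e ≠ d := by
    by_contra hcon
    push Not at hcon
    have hsub : G.neighborFinset x ⊆ {c, d} := by
      intro z hz
      rw [SimpleGraph.mem_neighborFinset] at hz
      by_cases hzc : z = c
      · simp [hzc]
      · simp [hcon z hz hzc]
    have := Finset.card_le_card hsub
    rw [G.card_neighborFinset_eq_degree] at this
    have h3 := hδ x
    have h4 : ({c, d} : Finset V).card ≤ 2 := Finset.card_le_two
    omega
  have fin : ∀ d e, c ≠ d → G.Adj x d → G.Adj x e → ∀ P Q R,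
      IsC G c (P ++ d :: (Q ++ e :: R)) → (P ++ d :: (Q ++ e :: R)).length = t.length →
      (∀ z, z ∈ c :: (P ++ d :: (Q ++ e :: R)) ↔ z ∈ a :: t) → False := by
    intro d e _ hxd hxe P Q R hC' hl' hm'
    obtain ⟨q1, q2, q3⟩ := hC'
    simp only [PP_app] at q3
    obtain ⟨hP, hQ, hR⟩ := q3
    have hn : (x :: c :: (P ++ d :: (Q ++ e :: R))).Nodup :=
      List.nodup_cons.2 ⟨fun h => hx ((hm' x).1 h), q1⟩
    refine three_false hcard hst hmax hP hQ hR (by simp at hl' ⊢; omega) hxc hxd hxe hn ?_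
    intro z hz
    by_contra hcon
    push Not at hcon
    have hzm := (hm' z).2 (hin z hz)
    simp only [List.mem_cons, List.mem_append] at hzm
    have : z ∈ P ∨ z ∈ Q ∨ z ∈ R := by tauto
    rcases this with h | h | h
    · obtain ⟨A, B, rfl⟩ := List.append_of_mem h
      rw [PP_app] at hP
      exact four_nbr hst hmax hP.1 hP.2 hQ hR (by simp at hl' ⊢; omega) hxc hz hxd hxe
        (by simpa using hn)
    · obtain ⟨A, B, rfl⟩ := List.append_of_mem h
      rw [PP_app] at hQ
      exact four_nbr hst hmax hP hQ.1 hQ.2 hR (by simp at hl' ⊢; omega) hxc hxd hz hxe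
        (by simpa using hn)
    · obtain ⟨A, B, rfl⟩ := List.append_of_mem h
      rw [PP_app] at hR
      exact four_nbr hst hmax hP hQ hR.1 hR.2 (by simp at hl' ⊢; omega) hxc hxd hxe hz
        (by simpa using hn)
  obtain ⟨t', hC', hl', hm'⟩ := IsC_rot hC hc
  have hd' : d ∈ t' := by
    rcases List.mem_cons.1 ((hm' d).2 hd) with e | e
    · exact absurd e hdc
    · exact e
  have he' : e ∈ t' := by
    rcases List.mem_cons.1 ((hm' e).2 (hin e hxe)) with e | e
    · exact absurd e hec
    · exact e
  obtain ⟨P, Q, rfl⟩ := List.append_of_mem hd'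
  have : e ∈ P ∨ e ∈ Q := by
    simp only [List.mem_cons, List.mem_append] at he'
    tauto
  rcases this with h | h
  · obtain ⟨A, B, rfl⟩ := List.append_of_mem h
    refine fin e d hec.symm hxe hxd A B Q ?_ ?_ ?_
    · simpa using hC'
    · simpa using hl'
    · simpa using hm'
  · obtain ⟨A, B, rfl⟩ := List.append_of_mem h
    exact fin d e hdc.symm hxd hxe P A B hC' hl' hm'
end

/-! ### Shortening cycles: a small verified case-split checker on nine vertices -/

/-- A case split certificate: `win` exhibits a path, `bad` exhibits five vertices with at most two
possible edges, and `br` splits on whether two vertices are adjacent. -/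
inductive Cert where
  | win (a : ℕ) (l : List ℕ) (b : ℕ) : Cert
  | bad (a b c d e : ℕ) : Cert
  | br (i j : ℕ) (y n : Cert) : Cert

/-- membership of an unordered pair -/
def memPair (E : List (ℕ × ℕ)) (i j : ℕ) : Bool := E.contains (i, j) || E.contains (j, i)

/-- boolean version of `PP` -/
def pathIn (E : List (ℕ × ℕ)) : ℕ → List ℕ → ℕ → Bool
  | a, [], b => memPair E a b
  | a, c :: l, b => memPair E a c && pathIn E c l b

/-- upper bound for the edge indicator -/
def ub (N : List (ℕ × ℕ)) (a b : ℕ) : ℕ := if memPair N a b then 0 else 1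

/-- the certificate checker -/
def chk (goal : ℕ → List ℕ → ℕ → Bool) : Cert → List (ℕ × ℕ) → List (ℕ × ℕ) → Bool
  | .win a l b, E, _ => goal a l b && pathIn E a l b
  | .bad a b c d e, _, N => decide ([a, b, c, d, e].Nodup) && decide (∀ x ∈ [a, b, c, d, e], x < 9) &&
      decide (ub N a b + ub N a c + ub N a d + ub N a e + ub N b c + ub N b d + ub N b e
      + ub N c d + ub N c e + ub N d e ≤ 2)
  | .br i j y n, E, N => chk goal y ((i, j) :: E) N && chk goal n E ((i, j) :: N)

section
variable {V : Type*} [DecidableEq V] {G : SimpleGraph V} [DecidableRel G.Adj]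

theorem memPair_adj {f : ℕ → V} {E : List (ℕ × ℕ)} (hE : ∀ p ∈ E, G.Adj (f p.1) (f p.2)) {i j : ℕ}
    (h : memPair E i j = true) : G.Adj (f i) (f j) := by
  simp only [memPair, Bool.or_eq_true, List.contains_iff_mem] at h
  rcases h with h | h
  · exact hE _ h
  · exact (hE _ h).symm

theorem memPair_nadj {f : ℕ → V} {N : List (ℕ × ℕ)} (hN : ∀ p ∈ N, ¬ G.Adj (f p.1) (f p.2)) (i j : ℕ) :
    ind G (f i) (f j) ≤ ub N i j := by
  unfold ind ub
  by_cases h : memPair N i j = true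
  · have : ¬ G.Adj (f i) (f j) := by
      simp only [memPair, Bool.or_eq_true, List.contains_iff_mem] at h
      rcases h with h | h
      · exact hN _ h
      · exact fun e => hN _ h e.symm
    simp [this]
  · rw [if_neg h]
    split_ifs <;> omega

theorem pathIn_PP {f : ℕ → V} {E : List (ℕ × ℕ)} (hE : ∀ p ∈ E, G.Adj (f p.1) (f p.2)) {a b : ℕ}
    {l : List ℕ} (h : pathIn E a l b = true) : PP G (f a) (l.map f) (f b) := by
  induction l generalizing a with
  | nil => exact memPair_adj hE h
  | cons c l ih =>
    simp only [pathIn, Bool.and_eq_true] at h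
    exact ⟨memPair_adj hE h.1, ih h.2⟩

theorem chk_sound (hst : IsSTGraph G 5 3) {f : ℕ → V} (hf : Set.InjOn f {i | i < 9})
    {goal : ℕ → List ℕ → ℕ → Bool} (C : Cert) (E N : List (ℕ × ℕ))
    (hE : ∀ p ∈ E, G.Adj (f p.1) (f p.2)) (hN : ∀ p ∈ N, ¬ G.Adj (f p.1) (f p.2))
    (h : chk goal C E N = true) :
    ∃ a l b, goal a l b = true ∧ PP G (f a) (l.map f) (f b) := by
  induction C generalizing E N with
  | win a l b =>
    simp only [chk, Bool.and_eq_true] at h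
    exact ⟨a, l, b, h.1, pathIn_PP hE h.2⟩
  | bad a b c d e =>
    exfalso
    simp only [chk, Bool.and_eq_true, decide_eq_true_eq] at h
    obtain ⟨⟨h1, h2⟩, h3⟩ := h
    have hnd : ([a, b, c, d, e].map f).Nodup :=
      List.Nodup.map_on (fun x hx y hy hxy => hf (h2 x hx) (h2 y hy) hxy) h1
    have := five hst hnd
    have g := memPair_nadj hN
    have := g a b
    have := g a c
    have := g a d
    have := g a e
    have := g b c
    have := g b d
    have := g b e
    have := g c d
    have := g c e
    have := g d e
    omega
  | br i j y n ihy ihn =>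
    simp only [chk, Bool.and_eq_true] at h
    by_cases hij : G.Adj (f i) (f j)
    · refine ihy _ N ?_ hN h.1
      intro p hp
      rcases List.mem_cons.1 hp with rfl | hp
      · exact hij
      · exact hE p hp
    · refine ihn E _ hE ?_ h.2
      intro p hp
      rcases List.mem_cons.1 hp with rfl | hp
      · exact hij
      · exact hN p hp
end

/-- goal: a path from `0` to `8` through six of the vertices `1, …, 7` -/
def goalDown (a : ℕ) (l : List ℕ) (b : ℕ) : Bool :=
  decide (a = 0) && decide (b = 8) && decide (l.length = 6) && decide (l.Nodup) &&
    decide (∀ x ∈ l, 0 < x ∧ x < 8)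

/-- goal: a cycle of length `L` -/
def goalCyc (L a : ℕ) (l : List ℕ) (b : ℕ) : Bool :=
  decide (a = b) && decide (l.length + 1 = L) && decide ((a :: l).Nodup) &&
    decide (∀ x ∈ a :: l, x < 9)

/-- the path `0, …, 8` -/
def pathE : List (ℕ × ℕ) := [(0,1),(1,2),(2,3),(3,4),(4,5),(5,6),(6,7),(7,8)]

/-- certificate for goalDown -/
def certDown : Cert :=
  (.br 2 4 (.win 0 [1,2,4,5,6,7] 8) (.br 1 3 (.win 0 [1,3,4,5,6,7] 8) (.br 6 8 (.win 0
  [1,2,3,4,5,6] 8) (.br 3 5 (.win 0 [1,2,3,5,6,7] 8) (.br 5 7 (.win 0 [1,2,3,4,5,7] 8) (.br 0 2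
  (.win 0 [2,3,4,5,6,7] 8) (.br 4 6 (.win 0 [1,2,3,4,6,7] 8) (.br 2 6 (.br 3 8 (.win 0
  [1,2,6,5,4,3] 8) (.br 0 5 (.win 0 [5,4,3,2,6,7] 8) (.br 1 4 (.win 0 [1,4,3,2,6,7] 8) (.br 4 7
  (.win 0 [1,2,6,5,4,7] 8) (.br 0 4 (.br 1 7 (.win 0 [4,5,6,2,1,7] 8) (.br 3 7 (.win 0
  [4,5,6,2,3,7] 8) (.br 1 5 (.win 0 [4,5,1,2,6,7] 8) (.bad 1 3 4 5 7)))) (.br 2 5 (.br 0 3 (.win 0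
  [3,4,5,2,6,7] 8) (.br 3 7 (.win 0 [1,2,5,4,3,7] 8) (.br 0 7 (.br 5 8 (.win 0 [7,6,2,3,4,5] 8)
  (.br 4 8 (.win 0 [7,6,5,2,3,4] 8) (.br 2 8 (.win 0 [7,6,5,4,3,2] 8) (.br 0 6 (.br 1 8 (.win 0
  [6,5,4,3,2,1] 8) (.br 3 6 (.br 1 5 (.win 0 [1,5,4,3,6,7] 8) (.bad 0 1 3 5 8)) (.bad 1 3 4 6 8)))
  (.bad 0 2 4 6 8))))) (.bad 0 3 4 5 7)))) (.br 0 7 (.br 2 7 (.br 0 6 (.win 0 [6,5,4,3,2,7] 8)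
  (.br 4 8 (.win 0 [1,2,7,6,5,4] 8) (.br 2 8 (.win 0 [7,6,5,4,3,2] 8) (.bad 0 2 4 6 8)))) (.bad 0
  2 4 5 7)) (.bad 0 2 4 5 7)))))))) (.br 1 6 (.br 3 7 (.win 0 [1,6,5,4,3,7] 8) (.br 2 8 (.win 0
  [1,6,5,4,3,2] 8) (.br 0 4 (.win 0 [4,3,2,1,6,7] 8) (.br 4 8 (.br 0 3 (.win 0 [3,2,1,6,5,4] 8)
  (.br 2 7 (.win 0 [1,6,7,2,3,4] 8) (.br 0 5 (.win 0 [5,6,1,2,3,4] 8) (.br 0 7 (.win 0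
  [7,6,1,2,3,4] 8) (.bad 0 2 3 5 7))))) (.bad 0 2 4 6 8))))) (.br 2 7 (.br 0 6 (.win 0
  [6,5,4,3,2,7] 8) (.br 4 8 (.win 0 [1,2,7,6,5,4] 8) (.br 0 4 (.br 2 8 (.br 1 4 (.win 0
  [1,4,5,6,7,2] 8) (.br 1 8 (.win 0 [4,5,6,7,2,1] 8) (.bad 1 2 4 6 8))) (.bad 0 2 4 6 8)) (.bad 0
  2 4 6 8)))) (.br 3 7 (.br 2 5 (.win 0 [1,2,5,4,3,7] 8) (.br 5 8 (.win 0 [1,2,3,7,6,5] 8) (.br 2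
  8 (.br 0 7 (.win 0 [7,6,5,4,3,2] 8) (.br 0 4 (.win 0 [4,5,6,7,3,2] 8) (.br 0 6 (.br 4 7 (.win 0
  [6,5,4,7,3,2] 8) (.bad 0 2 4 6 7)) (.bad 0 2 4 6 7)))) (.br 4 8 (.br 1 5 (.win 0 [1,5,6,7,3,4]
  8) (.br 1 8 (.br 0 6 (.win 0 [6,5,4,3,2,1] 8) (.br 0 5 (.win 0 [5,6,7,3,2,1] 8) (.bad 0 2 5 6
  8))) (.bad 1 2 5 6 8))) (.bad 2 4 5 6 8))))) (.br 3 6 (.br 4 8 (.win 0 [1,2,3,6,5,4] 8) (.br 0 4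
  (.br 1 4 (.win 0 [4,1,2,3,6,7] 8) (.br 1 8 (.win 0 [4,5,6,3,2,1] 8) (.bad 1 2 4 6 8))) (.br 0 6
  (.br 2 8 (.br 1 8 (.win 0 [6,5,4,3,2,1] 8) (.br 1 4 (.win 0 [1,4,5,6,3,2] 8) (.bad 1 2 4 6 8)))
  (.bad 0 2 4 6 8)) (.bad 0 2 4 6 8)))) (.br 1 5 (.br 0 3 (.win 0 [3,2,1,5,6,7] 8) (.br 0 4 (.br 2
  5 (.win 0 [4,3,2,5,6,7] 8) (.br 0 5 (.br 0 7 (.br 3 8 (.win 0 [7,6,5,1,2,3] 8) (.br 1 7 (.win 0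
  [5,4,3,2,1,7] 8) (.br 1 8 (.br 0 6 (.win 0 [6,5,4,3,2,1] 8) (.br 2 8 (.win 0 [7,6,5,4,3,2] 8)
  (.bad 0 2 3 6 8))) (.bad 1 3 6 7 8)))) (.bad 0 2 3 5 7)) (.bad 0 2 3 5 7))) (.br 0 6 (.br 1 8
  (.win 0 [6,5,4,3,2,1] 8) (.br 4 8 (.win 0 [6,5,1,2,3,4] 8) (.br 1 4 (.br 3 8 (.win 0
  [6,5,4,1,2,3] 8) (.bad 1 3 4 6 8)) (.bad 1 3 4 6 8)))) (.bad 0 2 3 4 6)))) (.br 1 7 (.br 3 8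
  (.win 0 [1,7,6,5,4,3] 8) (.br 1 8 (.br 5 8 (.br 0 7 (.win 0 [7,1,2,3,4,5] 8) (.br 0 6 (.win 0
  [6,5,4,3,2,1] 8) (.br 0 3 (.win 0 [3,2,1,7,6,5] 8) (.bad 0 2 3 6 7)))) (.bad 1 3 5 6 8)) (.bad 1
  3 5 6 8))) (.bad 1 3 5 6 7)))))))))))))))

theorem certDown_ok : chk goalDown certDown pathE [] = true := by
  decide +kernel

/-- certificate for goalCyc 3 -/
def cert3 : Cert :=
  (.br 0 2 (.win 0 [1,2] 0) (.br 5 7 (.win 5 [6,7] 5) (.br 3 5 (.win 3 [4,5] 3) (.br 6 8 (.win 6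
  [7,8] 6) (.br 1 8 (.win 0 [1,8] 0) (.br 2 4 (.win 2 [3,4] 2) (.br 1 3 (.win 1 [2,3] 1) (.br 4 6
  (.win 4 [5,6] 4) (.br 0 7 (.win 0 [7,8] 0) (.br 3 7 (.br 4 7 (.win 3 [4,7] 3) (.br 2 7 (.win 2
  [3,7] 2) (.br 3 6 (.win 3 [6,7] 3) (.br 3 8 (.win 3 [7,8] 3) (.br 0 4 (.br 4 8 (.win 0 [4,8] 0)
  (.br 1 4 (.win 0 [1,4] 0) (.bad 1 3 4 6 8))) (.br 0 5 (.br 0 6 (.win 0 [5,6] 0) (.bad 0 2 4 6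
  7)) (.bad 0 2 4 5 7))))))) (.br 1 5 (.br 2 5 (.win 1 [2,5] 1) (.br 1 4 (.win 1 [4,5] 1) (.br 1 6
  (.win 1 [5,6] 1) (.br 0 5 (.win 0 [1,5] 0) (.br 2 7 (.br 2 8 (.win 2 [7,8] 2) (.br 2 6 (.win 2
  [6,7] 2) (.bad 1 2 4 6 8))) (.bad 0 2 3 5 7)))))) (.br 0 3 (.br 3 8 (.win 0 [3,8] 0) (.br 1 7
  (.br 2 7 (.win 1 [2,7] 1) (.br 1 6 (.win 1 [6,7] 1) (.br 3 6 (.br 0 6 (.win 0 [3,6] 0) (.br 0 4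
  (.win 0 [3,4] 0) (.br 2 6 (.win 2 [3,6] 2) (.bad 0 2 4 6 7)))) (.bad 1 3 5 6 8)))) (.bad 1 3 5 7
  8))) (.br 0 5 (.br 1 7 (.br 0 6 (.win 0 [5,6] 0) (.br 0 4 (.win 0 [4,5] 0) (.br 2 7 (.win 1
  [2,7] 1) (.br 2 5 (.br 2 6 (.win 2 [5,6] 2) (.bad 0 2 4 6 7)) (.bad 0 2 3 5 7))))) (.bad 0 1 3 5
  7)) (.bad 0 1 3 5 7))))))))))))))

theorem cert3_ok : chk (goalCyc 3) cert3 ((8, 0) :: pathE) [] = true := by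
  decide +kernel

/-- certificate for goalCyc 4 -/
def cert4 : Cert :=
  (.br 1 7 (.win 0 [1,7,8] 0) (.br 0 6 (.win 0 [6,7,8] 0) (.br 1 4 (.win 1 [2,3,4] 1) (.br 5 8
  (.win 5 [6,7,8] 5) (.br 3 6 (.win 3 [4,5,6] 3) (.br 2 8 (.win 0 [1,2,8] 0) (.br 2 5 (.win 2
  [3,4,5] 2) (.br 0 3 (.win 0 [1,2,3] 0) (.br 4 7 (.win 4 [5,6,7] 4) (.br 2 4 (.br 1 5 (.win 1
  [2,4,5] 1) (.br 2 6 (.win 2 [4,5,6] 2) (.br 1 3 (.win 1 [2,4,3] 1) (.br 3 5 (.win 2 [3,5,4] 2)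
  (.br 0 2 (.br 3 8 (.win 0 [2,3,8] 0) (.br 1 8 (.win 0 [2,1,8] 0) (.bad 1 2 3 5 8))) (.br 0 5
  (.br 6 8 (.win 0 [5,6,8] 0) (.br 3 8 (.br 1 8 (.win 1 [2,3,8] 1) (.br 1 6 (.win 0 [1,6,5] 0)
  (.bad 1 3 5 6 8))) (.bad 2 3 5 6 8))) (.bad 0 2 3 5 6))))))) (.br 1 8 (.br 1 6 (.win 1 [6,7,8]
  1) (.br 0 2 (.win 0 [2,1,8] 0) (.br 0 7 (.win 0 [1,8,7] 0) (.br 2 7 (.win 1 [2,7,8] 1) (.br 0 4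
  (.br 4 8 (.win 0 [1,8,4] 0) (.br 5 7 (.br 3 7 (.win 3 [4,5,7] 3) (.br 1 3 (.win 0 [1,3,4] 0)
  (.bad 0 1 3 6 7))) (.bad 2 4 5 7 8))) (.bad 0 1 2 4 7)))))) (.br 1 5 (.br 3 5 (.win 1 [2,3,5] 1)
  (.br 2 6 (.win 1 [2,6,5] 1) (.br 0 4 (.win 0 [1,5,4] 0) (.br 0 2 (.br 3 8 (.win 0 [2,3,8] 0)
  (.br 6 8 (.br 2 7 (.win 0 [2,7,8] 0) (.br 4 8 (.win 4 [5,6,8] 4) (.bad 1 2 4 7 8))) (.bad 2 3 5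
  6 8))) (.br 0 5 (.br 4 6 (.br 6 8 (.win 0 [5,6,8] 0) (.br 4 8 (.win 4 [6,7,8] 4) (.bad 0 2 4 6
  8))) (.bad 0 2 3 4 6)) (.bad 0 2 3 5 6)))))) (.br 4 8 (.br 3 7 (.win 3 [4,8,7] 3) (.br 0 5 (.win
  0 [5,4,8] 0) (.br 5 7 (.win 4 [5,7,8] 4) (.br 2 7 (.br 0 7 (.win 0 [1,2,7] 0) (.br 1 3 (.br 0 4
  (.win 0 [1,3,4] 0) (.bad 0 1 4 5 7)) (.bad 0 1 3 5 7))) (.bad 1 2 4 5 7))))) (.bad 1 2 4 5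
  8))))))))))))))

theorem cert4_ok : chk (goalCyc 4) cert4 ((8, 0) :: pathE) [] = true := by
  decide +kernel

/-- certificate for goalCyc 5 -/
def cert5 : Cert :=
  (.br 3 8 (.win 0 [1,2,3,8] 0) (.br 3 7 (.win 3 [4,5,6,7] 3) (.br 4 8 (.win 4 [5,6,7,8] 4) (.br 2
  7 (.win 0 [1,2,7,8] 0) (.br 1 5 (.win 1 [2,3,4,5] 1) (.br 2 6 (.win 2 [3,4,5,6] 2) (.br 1 6
  (.win 0 [1,6,7,8] 0) (.br 0 5 (.win 0 [5,6,7,8] 0) (.br 0 4 (.win 0 [1,2,3,4] 0) (.br 2 8 (.br 1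
  3 (.win 0 [1,3,2,8] 0) (.br 0 7 (.win 0 [1,2,8,7] 0) (.br 2 5 (.win 2 [5,6,7,8] 2) (.br 4 7
  (.win 2 [3,4,7,8] 2) (.br 0 2 (.br 1 4 (.win 0 [1,4,3,2] 0) (.br 1 7 (.win 0 [1,7,8,2] 0) (.br 1
  8 (.br 0 3 (.win 0 [3,2,1,8] 0) (.bad 0 1 3 4 7)) (.bad 1 3 4 7 8)))) (.br 2 4 (.br 5 7 (.win 2
  [4,5,7,8] 2) (.bad 0 2 4 5 7)) (.bad 0 2 4 5 7))))))) (.br 1 4 (.br 3 5 (.win 1 [2,3,5,4] 1)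
  (.br 0 2 (.win 0 [1,4,3,2] 0) (.br 5 8 (.win 0 [1,4,5,8] 0) (.br 0 6 (.win 0 [1,4,5,6] 0) (.br 0
  3 (.br 2 4 (.win 0 [1,2,4,3] 0) (.br 2 5 (.br 4 6 (.win 2 [3,4,6,5] 2) (.bad 0 2 4 6 8)) (.bad 0
  2 4 5 8))) (.br 2 5 (.br 4 6 (.win 2 [3,4,6,5] 2) (.br 2 4 (.br 3 6 (.win 2 [3,6,5,4] 2) (.br 1
  3 (.win 1 [3,2,5,4] 1) (.bad 0 1 3 5 6))) (.bad 0 2 4 6 8))) (.bad 0 2 3 5 8))))))) (.br 0 3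
  (.br 2 4 (.win 0 [1,2,4,3] 0) (.br 1 8 (.win 0 [3,2,1,8] 0) (.br 4 6 (.br 6 8 (.win 0 [3,4,6,8]
  0) (.bad 1 2 4 6 8)) (.bad 1 2 4 6 8)))) (.br 2 5 (.br 4 6 (.win 2 [3,4,6,5] 2) (.br 0 6 (.win 0
  [1,2,5,6] 0) (.br 1 3 (.win 1 [2,5,4,3] 1) (.br 3 6 (.br 2 4 (.win 2 [3,6,5,4] 2) (.br 1 8 (.br
  6 8 (.win 1 [2,3,6,8] 1) (.bad 1 2 4 6 8)) (.bad 1 2 4 6 8))) (.bad 0 1 3 4 6))))) (.br 3 6 (.br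
  2 4 (.win 2 [3,6,5,4] 2) (.br 5 7 (.win 3 [4,5,7,6] 3) (.br 1 7 (.win 1 [2,3,6,7] 1) (.br 4 7
  (.br 3 5 (.win 3 [4,7,6,5] 3) (.br 0 2 (.br 0 7 (.win 0 [2,3,6,7] 0) (.bad 0 2 3 5 7)) (.bad 0 2
  3 5 7))) (.bad 1 2 4 5 7))))) (.br 4 7 (.br 3 5 (.win 3 [4,7,6,5] 3) (.br 6 8 (.win 4 [5,6,8,7]
  4) (.br 5 8 (.br 4 6 (.win 4 [5,8,7,6] 4) (.br 0 6 (.br 1 8 (.win 0 [1,8,5,6] 0) (.bad 1 2 4 6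
  8)) (.bad 0 3 4 6 8))) (.bad 2 3 5 6 8)))) (.br 5 8 (.br 4 6 (.win 4 [5,8,7,6] 4) (.br 0 7 (.win
  0 [7,6,5,8] 0) (.br 0 6 (.br 5 7 (.win 0 [6,7,5,8] 0) (.br 0 2 (.br 3 5 (.win 0 [2,3,5,8] 0)
  (.bad 0 2 3 5 7)) (.bad 0 2 3 5 7))) (.bad 0 3 4 6 7)))) (.br 5 7 (.br 0 6 (.win 0 [6,5,7,8] 0)
  (.br 0 7 (.br 6 8 (.win 0 [7,5,6,8] 0) (.br 0 2 (.br 1 8 (.win 0 [2,1,8,7] 0) (.bad 1 2 5 6 8))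
  (.bad 0 2 5 6 8))) (.br 4 6 (.br 3 5 (.win 3 [4,6,7,5] 3) (.br 6 8 (.win 4 [5,7,8,6] 4) (.bad 0
  3 5 6 8))) (.bad 0 3 4 6 7)))) (.br 3 5 (.br 2 4 (.br 4 6 (.win 2 [3,5,6,4] 2) (.br 1 3 (.win 1
  [2,4,5,3] 1) (.br 0 6 (.br 1 8 (.win 0 [1,8,7,6] 0) (.bad 1 3 4 6 8)) (.bad 0 1 3 4 6)))) (.bad
  2 4 5 7 8)) (.bad 2 3 5 7 8)))))))))))))))))))

theorem cert5_ok : chk (goalCyc 5) cert5 ((8, 0) :: pathE) [] = true := by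
  decide +kernel

/-- certificate for goalCyc 6 -/
def cert6 : Cert :=
  (.br 1 6 (.win 1 [2,3,4,5,6] 1) (.br 4 8 (.win 0 [1,2,3,4,8] 0) (.br 0 4 (.win 0 [4,5,6,7,8] 0)
  (.br 2 6 (.win 0 [1,2,6,7,8] 0) (.br 3 8 (.win 3 [4,5,6,7,8] 3) (.br 1 5 (.win 0 [1,5,6,7,8] 0)
  (.br 3 7 (.win 0 [1,2,3,7,8] 0) (.br 2 7 (.win 2 [3,4,5,6,7] 2) (.br 0 5 (.win 0 [1,2,3,4,5] 0)
  (.br 4 7 (.br 0 6 (.win 0 [6,5,4,7,8] 0) (.br 2 4 (.win 0 [1,2,4,7,8] 0) (.br 2 5 (.win 2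
  [3,4,7,6,5] 2) (.br 0 2 (.win 0 [2,3,4,7,8] 0) (.br 4 6 (.br 0 3 (.win 0 [3,4,6,7,8] 0) (.br 2 8
  (.win 2 [3,4,6,7,8] 2) (.br 5 8 (.br 0 7 (.win 0 [7,4,6,5,8] 0) (.br 3 5 (.win 3 [4,6,7,8,5] 3)
  (.bad 0 2 3 5 7))) (.bad 0 2 4 5 8)))) (.bad 0 2 4 5 6)))))) (.br 0 3 (.br 0 7 (.win 0
  [3,4,5,6,7] 0) (.br 3 5 (.win 0 [3,5,6,7,8] 0) (.br 2 5 (.win 0 [1,2,5,4,3] 0) (.br 5 7 (.win 0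
  [3,4,5,7,8] 0) (.br 2 4 (.br 5 8 (.win 0 [1,2,4,5,8] 0) (.br 2 8 (.win 2 [4,5,6,7,8] 2) (.bad 2
  3 5 7 8))) (.bad 0 2 4 5 7)))))) (.br 1 7 (.br 5 8 (.win 0 [1,7,6,5,8] 0) (.br 1 3 (.win 1
  [3,4,5,6,7] 1) (.br 5 7 (.win 1 [2,3,4,5,7] 1) (.br 3 5 (.win 1 [2,3,5,6,7] 1) (.br 1 8 (.br 0 7
  (.br 3 6 (.win 0 [1,2,3,6,7] 0) (.br 6 8 (.br 0 6 (.br 0 2 (.win 0 [2,1,8,6,7] 0) (.br 2 5 (.win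
  0 [6,5,2,1,8] 0) (.bad 0 2 3 5 7))) (.bad 0 1 3 5 6)) (.bad 1 3 5 6 8))) (.bad 0 3 5 7 8)) (.bad
  1 3 5 7 8)))))) (.br 3 6 (.br 1 3 (.win 0 [1,3,6,7,8] 0) (.br 0 7 (.win 0 [1,2,3,6,7] 0) (.br 1
  4 (.win 1 [2,3,6,5,4] 1) (.bad 0 1 3 4 7)))) (.br 0 6 (.br 4 6 (.win 0 [1,2,3,4,6] 0) (.br 2 4
  (.win 0 [1,2,4,5,6] 0) (.br 1 4 (.br 0 7 (.win 0 [1,4,5,6,7] 0) (.br 0 2 (.win 0 [2,1,4,5,6] 0)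
  (.bad 0 2 3 4 7))) (.bad 1 2 4 6 7)))) (.br 6 8 (.br 1 4 (.win 0 [1,4,5,6,8] 0) (.br 2 5 (.win 0
  [1,2,5,6,8] 0) (.br 0 2 (.br 4 6 (.win 0 [2,3,4,6,8] 0) (.br 2 4 (.win 0 [2,4,5,6,8] 0) (.bad 1
  2 4 6 7))) (.br 0 7 (.br 3 5 (.br 5 7 (.win 0 [1,2,3,5,7] 0) (.br 2 4 (.br 5 8 (.win 0
  [1,2,4,5,8] 0) (.br 1 8 (.win 1 [2,4,5,6,8] 1) (.bad 1 4 5 7 8))) (.bad 0 2 4 5 7))) (.bad 0 2 3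
  5 6)) (.bad 0 2 3 6 7))))) (.br 4 6 (.br 2 8 (.win 2 [3,4,6,7,8] 2) (.br 0 2 (.br 2 5 (.win 0
  [2,5,6,7,8] 0) (.br 0 7 (.win 0 [2,3,4,6,7] 0) (.br 1 3 (.br 1 8 (.win 1 [3,4,6,7,8] 1) (.br 5 8
  (.win 0 [2,3,4,5,8] 0) (.bad 1 2 5 6 8))) (.bad 0 1 3 6 7)))) (.bad 0 2 3 6 8))) (.bad 0 3 4 6
  8)))))))))))))))))

theorem cert6_ok : chk (goalCyc 6) cert6 ((8, 0) :: pathE) [] = true := by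
  decide +kernel

/-- certificate for goalCyc 7 -/
def cert7 : Cert :=
  (.br 2 5 (.win 0 [1,2,5,6,7,8] 0) (.br 4 7 (.win 0 [1,2,3,4,7,8] 0) (.br 1 4 (.win 0
  [1,4,5,6,7,8] 0) (.br 0 6 (.win 0 [1,2,3,4,5,6] 0) (.br 0 3 (.win 0 [3,4,5,6,7,8] 0) (.br 1 7
  (.win 1 [2,3,4,5,6,7] 1) (.br 2 8 (.win 2 [3,4,5,6,7,8] 2) (.br 5 8 (.win 0 [1,2,3,4,5,8] 0)
  (.br 3 6 (.win 0 [1,2,3,6,7,8] 0) (.br 1 8 (.br 0 5 (.win 0 [5,4,3,2,1,8] 0) (.br 3 5 (.win 1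
  [2,3,5,6,7,8] 1) (.br 6 8 (.win 1 [2,3,4,5,6,8] 1) (.br 3 8 (.br 1 6 (.win 0 [1,6,5,4,3,8] 0)
  (.br 1 5 (.win 1 [2,3,8,7,6,5] 1) (.br 1 3 (.win 1 [3,4,5,6,7,8] 1) (.bad 0 1 3 5 6)))) (.bad 0
  3 5 6 8))))) (.br 6 8 (.br 3 7 (.win 0 [1,2,3,7,6,8] 0) (.br 4 6 (.win 0 [1,2,3,4,6,8] 0) (.br 1
  3 (.win 0 [1,3,4,5,6,8] 0) (.br 1 6 (.br 3 8 (.win 0 [1,6,5,4,3,8] 0) (.br 4 8 (.win 1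
  [2,3,4,8,7,6] 1) (.bad 1 3 4 7 8))) (.bad 1 3 4 6 7))))) (.br 4 8 (.br 2 6 (.win 0 [1,2,6,5,4,8]
  0) (.br 3 5 (.win 0 [1,2,3,5,4,8] 0) (.br 3 8 (.br 1 6 (.win 1 [2,3,8,4,5,6] 1) (.br 1 5 (.win 1
  [2,3,8,7,6,5] 1) (.bad 1 2 5 6 8))) (.bad 2 3 5 6 8)))) (.br 1 5 (.br 4 6 (.win 0 [1,5,4,6,7,8]
  0) (.br 1 6 (.br 3 8 (.win 0 [1,6,5,4,3,8] 0) (.br 0 4 (.win 0 [4,5,1,6,7,8] 0) (.bad 0 3 4 6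
  8))) (.bad 1 4 6 7 8))) (.br 5 7 (.br 2 4 (.win 0 [1,2,4,5,7,8] 0) (.bad 1 2 4 5 8)) (.bad 1 4 5
  7 8)))))))))))))))

theorem cert7_ok : chk (goalCyc 7) cert7 ((8, 0) :: pathE) [] = true := by
  decide +kernel

section
variable {V : Type*} [DecidableEq V] {G : SimpleGraph V} [DecidableRel G.Adj]

theorem nine (x0 x1 x2 x3 x4 x5 x6 x7 x8 : V) (rest : List V)
    (hp : PP G x0 [x1, x2, x3, x4, x5, x6, x7] x8)
    (hn : (x0 :: ([x1, x2, x3, x4, x5, x6, x7] ++ x8 :: rest)).Nodup) :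
    ∃ f : ℕ → V, f 0 = x0 ∧ f 8 = x8 ∧ Set.InjOn f {i | i < 9} ∧
      (∀ p ∈ pathE, G.Adj (f p.1) (f p.2)) ∧
      ∀ i < 9, f i ∈ [x0, x1, x2, x3, x4, x5, x6, x7, x8] := by
  let L := [x0, x1, x2, x3, x4, x5, x6, x7, x8]
  have hL : L.Nodup := nodup_of_count hn (by
    intro x; simp only [L, List.count_append, List.count_cons, List.count_nil]; omega)
  refine ⟨fun i => L.getD i x0, rfl, rfl, ?_, ?_, ?_⟩
  · intro i hi j hj hij
    have hi' : i < L.length := hi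
    have hj' : j < L.length := hj
    simp only [List.getD_eq_getElem _ _ hi', List.getD_eq_getElem _ _ hj'] at hij
    exact (hL.getElem_inj_iff).1 hij
  · simp only [PP_cons, PP_nil] at hp
    simp [pathE, L, hp]
  · intro i hi
    have hi' : i < L.length := hi
    simp only [List.getD_eq_getElem _ _ hi']
    exact List.getElem_mem hi'

/-- a cycle of length at least nine can be shortened by one -/
theorem step_down (hst : IsSTGraph G 5 3) {a : V} {t : List V} (h : IsC G a t) (hl : 8 ≤ t.length) :
    ∃ a' t', IsC G a' t' ∧ t'.length + 1 = t.length := by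
  match t, hl with
  | x1 :: x2 :: x3 :: x4 :: x5 :: x6 :: x7 :: x8 :: rest, _ =>
    obtain ⟨hn, -, hp⟩ := h
    have hp' : PP G a ([x1, x2, x3, x4, x5, x6, x7] ++ x8 :: rest) a := hp
    have hn' : (a :: ([x1, x2, x3, x4, x5, x6, x7] ++ x8 :: rest)).Nodup := hn
    rw [PP_app] at hp'
    obtain ⟨f, h0, h8, hinj, hE, hmem⟩ := nine _ _ _ _ _ _ _ _ _ rest hp'.1 hn'
    obtain ⟨i, l, j, hg, hpath⟩ := chk_sound hst hinj certDown pathE [] hE (by simp) certDown_ok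
    simp only [goalDown, Bool.and_eq_true, decide_eq_true_eq] at hg
    obtain ⟨⟨⟨⟨rfl, rfl⟩, g1⟩, g2⟩, g3⟩ := hg
    rw [h0, h8] at hpath
    refine ⟨a, l.map f ++ x8 :: rest, ⟨?_, ?_, PP_app.2 ⟨hpath, hp'.2⟩⟩, ?_⟩
    · have hmap : (l.map f).Nodup := List.Nodup.map_on (fun x hx y hy hxy =>
        hinj (show x < 9 by have := g3 x hx; omega) (show y < 9 by have := g3 y hy; omega) hxy) g2
      have hsub : ∀ z ∈ l.map f, z ∈ [x1, x2, x3, x4, x5, x6, x7] := by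
        intro z hz
        obtain ⟨i, hi, rfl⟩ := List.mem_map.1 hz
        have hi' := g3 i hi
        have h1 := hmem i (by omega)
        have h2 : f i ≠ a := by
          intro e
          have := hinj (show i < 9 by omega) (show 0 < 9 by omega) (e.trans h0.symm)
          omega
        have h3 : f i ≠ x8 := by
          intro e
          have := hinj (show i < 9 by omega) (show 8 < 9 by omega) (e.trans h8.symm)
          omega
        simp only [List.mem_cons, List.not_mem_nil, or_false] at h1 ⊢
        tauto
      rw [List.nodup_cons, List.nodup_append] at hn' ⊢
      obtain ⟨n1, n2, n3, n4⟩ := hn'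
      refine ⟨?_, hmap, n3, fun u hu v hv => n4 u (hsub u hu) v hv⟩
      intro hm
      rcases List.mem_append.1 hm with h | h
      · exact n1 (List.mem_append.2 (.inl (hsub _ h)))
      · exact n1 (List.mem_append.2 (.inr h))
    · simp [g1]; omega
    · simp [g1]; omega

/-- a cycle of length nine gives the short cycles -/
theorem short_cyc (hst : IsSTGraph G 5 3) {a : V} {t : List V} (h : IsC G a t) (hl : t.length = 8)
    {L : ℕ} (hL3 : 3 ≤ L) {C : Cert} (hC : chk (goalCyc L) C ((8, 0) :: pathE) [] = true) :
    ∃ a' t', IsC G a' t' ∧ t'.length + 1 = L := by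
  match t, hl with
  | [x1, x2, x3, x4, x5, x6, x7, x8], _ =>
    obtain ⟨hn, -, hp⟩ := h
    have hp' : PP G a ([x1, x2, x3, x4, x5, x6, x7] ++ x8 :: []) a := hp
    have hn' : (a :: ([x1, x2, x3, x4, x5, x6, x7] ++ x8 :: [])).Nodup := hn
    rw [PP_app] at hp'
    obtain ⟨f, h0, h8, hinj, hE, hmem⟩ := nine _ _ _ _ _ _ _ _ _ [] hp'.1 hn'
    obtain ⟨i, l, j, hg, hpath⟩ := chk_sound hst hinj C ((8, 0) :: pathE) [] (by
      intro p hp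
      rcases List.mem_cons.1 hp with rfl | hp
      · simpa [h0, h8, PP_nil] using hp'.2
      · exact hE p hp) (by simp) hC
    simp only [goalCyc, Bool.and_eq_true, decide_eq_true_eq] at hg
    obtain ⟨⟨⟨rfl, g1⟩, g2⟩, g3⟩ := hg
    refine ⟨f i, l.map f, ⟨?_, ?_, hpath⟩, by simpa using g1⟩
    · have : ((i :: l).map f).Nodup := List.Nodup.map_on (fun x hx y hy hxy =>
        hinj (g3 x hx) (g3 y hy) hxy) g2
      simpa using this
    · simp; omega

theorem all_lengths (hst : IsSTGraph G 5 3) (m : ℕ) : ∀ {a : V} {t : List V}, IsC G a t →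
    t.length + 1 = m + 9 → ∀ k, 3 ≤ k → k ≤ m + 9 → ∃ a' t', IsC G a' t' ∧ t'.length + 1 = k := by
  induction m with
  | zero =>
    intro a t h hl k hk3 hk9
    have hl' : t.length = 8 := by omega
    have : k = 3 ∨ k = 4 ∨ k = 5 ∨ k = 6 ∨ k = 7 ∨ k = 8 ∨ k = 9 := by omega
    rcases this with rfl | rfl | rfl | rfl | rfl | rfl | rfl
    · exact short_cyc hst h hl' hk3 cert3_ok
    · exact short_cyc hst h hl' hk3 cert4_ok
    · exact short_cyc hst h hl' hk3 cert5_ok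
    · exact short_cyc hst h hl' hk3 cert6_ok
    · exact short_cyc hst h hl' hk3 cert7_ok
    · obtain ⟨a', t', h1, h2⟩ := step_down hst h (by omega)
      exact ⟨a', t', h1, by omega⟩
    · exact ⟨a, t, h, by omega⟩
  | succ m ih =>
    intro a t h hl k hk3 hk
    rcases Nat.lt_or_ge (m + 9) k with hlt | hge
    · exact ⟨a, t, h, by omega⟩
    · obtain ⟨a', t', h1, h2⟩ := step_down hst h (by omega)
      exact ih h1 (by omega) k hk3 hge

end

/-- Every 2-connected [5,3]-graph of order at least 9 with minimum degree at least 3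
is pancyclic. -/
theorem stmt1 {V : Type*} [Fintype V] [DecidableEq V] (G : SimpleGraph V) [DecidableRel G.Adj]
    (h2 : TwoConnected G) (hst : IsSTGraph G 5 3) (hn : 9 ≤ Fintype.card V)
    (hδ : ∀ v : V, 3 ≤ G.degree v) :
    Pancyclic G := by
  intro k hk3 hk
  obtain ⟨a, t, hC, hl⟩ := ham h2 hst hn hδ
  obtain ⟨a', t', h, hlen⟩ := all_lengths hst (Fintype.card V - 9) hC (by omega) k hk3 (by omega)
  obtain ⟨v, c, hc, hc'⟩ := IsC_cycle h
  exact ⟨v, c, hc, by omega⟩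
end
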